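/- Let n ≥ 2. There exists an injective group homomorphism φ from T_n into T_2 = T which is a quasi-isometric embedding: for any finite generating set Σ of T_n and any finite generating set S of T_2, there exist constants A ≥ 1 and B ≥ 0 such that for all ω ∈ T_n, (1/A)·|ω|_Σ − B ≤ |φ(ω)|_S ≤ A·|ω|_Σ + B. -/

import Mathlib

noncomputable section

namespace ThompsonPaper

/-- The circle `ℝ/ℤ`. -/
abbrev Circle : Type := AddCircle (1 : ℝ)

/-- Homeomorphisms of a topological space form a group under composition,
with `(f * g) x = f (g x)`. -/
instance homeoGroup {α : Type*} [TopologicalSpace α] : Group (α ≃ₜ α) where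
  mul f g := g.trans f
  one := Homeomorph.refl α
  inv := Homeomorph.symm
  mul_assoc _ _ _ := Homeomorph.ext fun _ => rfl
  one_mul _ := Homeomorph.ext fun _ => rfl
  mul_one _ := Homeomorph.ext fun _ => rfl
  inv_mul_cancel f := Homeomorph.ext fun x => f.symm_apply_apply x

/-- `x` is an `n`-adic rational: `x = a / n ^ k` with `a` an integer, `k` a natural number. -/
def IsNAdic (n : ℕ) (x : ℝ) : Prop := ∃ a : ℤ, ∃ k : ℕ, x = (a : ℝ) / (n : ℝ) ^ k

/-- The set of `n`-adic points of the circle. -/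
def nAdicPoints (n : ℕ) : Set Circle := { p | ∃ x : ℝ, IsNAdic n x ∧ p = (x : Circle) }

/-- `F : ℝ → ℝ` is a lift of the circle map `f`. -/
def IsLift (f : Circle ≃ₜ Circle) (F : ℝ → ℝ) : Prop :=
  ∀ x : ℝ, f (x : Circle) = ((F x : ℝ) : Circle)

/-- `F : ℝ → ℝ` commutes with translation by `1` and is piecewise affine with finitely
many breakpoints (modulo `1`), all breakpoints at `n`-adic rationals, and with the slope
of every affine piece an integer power of `n`. -/
def PiecewiseNAffine (n : ℕ) (F : ℝ → ℝ) : Prop :=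
  (∀ x : ℝ, F (x + 1) = F x + 1) ∧
  ∃ m : ℕ, ∃ t : ℕ → ℝ, ∃ slope : ℕ → ℤ, ∃ c : ℕ → ℝ,
    0 < m ∧ t 0 = 0 ∧ t m = 1 ∧
    (∀ i, i < m → t i < t (i + 1)) ∧
    (∀ i, i ≤ m → IsNAdic n (t i)) ∧
    (∀ i, i < m → ∀ x ∈ Set.Icc (t i) (t (i + 1)),
      F x = (n : ℝ) ^ (slope i) * x + c i)

/-- Membership in Thompson's group `T_n`: an orientation-preserving homeomorphism of the
circle `ℝ/ℤ` mapping the set of `n`-adic points onto itself, which is piecewise affine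
with finitely many breakpoints, all breakpoints at `n`-adic points, and all slopes integer
powers of `n`.  (Orientation preservation and the piecewise affine structure are expressed
through a strictly increasing lift.) -/
def InT (n : ℕ) (f : Circle ≃ₜ Circle) : Prop :=
  f '' nAdicPoints n = nAdicPoints n ∧
  ∃ F : ℝ → ℝ, StrictMono F ∧ IsLift f F ∧ PiecewiseNAffine n F

/-- Thompson's group `T_n`, as a set of circle homeomorphisms. -/
def TnSet (n : ℕ) : Set (Circle ≃ₜ Circle) := { f | InT n f }

/-- Thompson's group `T_n`, as a subgroup of the homeomorphism group of the circle.
(The set `TnSet n` is closed under the group operations, so this subgroup has exactly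
`TnSet n` as its underlying set.) -/
def Tn (n : ℕ) : Subgroup (Circle ≃ₜ Circle) := Subgroup.closure (TnSet n)

/-- The word length of `g` with respect to a set `S` of generators: the least `k` such
that `g` is a product of `k` elements of `S ∪ S⁻¹`. -/
def wordLength {G : Type*} [Group G] (S : Set G) (g : G) : ℕ :=
  sInf { k : ℕ | ∃ w : List G, w.length = k ∧ (∀ x ∈ w, x ∈ S ∨ x⁻¹ ∈ S) ∧ w.prod = g }

lemma coe_eq_iff (x y : ℝ) : ((x : ℝ) : Circle) = (y : Circle) ↔ ∃ z : ℤ, x = y + z := by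
  rw [QuotientAddGroup.eq_iff_sub_mem, AddSubgroup.mem_zmultiples_iff]
  constructor
  · rintro ⟨z, hz⟩
    refine ⟨z, ?_⟩
    simp at hz
    linarith
  · rintro ⟨z, hz⟩
    refine ⟨z, ?_⟩
    simp
    linarith

lemma coe_add_int (x : ℝ) (z : ℤ) : ((x + z : ℝ) : Circle) = (x : Circle) :=
  (coe_eq_iff _ _).2 ⟨z, rfl⟩

/-- if congruent mod 1 and both in (0,1] -/
lemma eq_of_coe_Ioc {x y : ℝ} (h : (x : Circle) = (y : Circle)) (hx : 0 < x) (hx1 : x ≤ 1)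
    (hy : 0 < y) (hy1 : y ≤ 1) : x = y := by
  obtain ⟨z, hz⟩ := (coe_eq_iff _ _).1 h
  have h1 : (z : ℝ) < 1 := by linarith
  have h2 : (-1 : ℝ) < z := by linarith
  have h1' : z < 1 := by exact_mod_cast h1
  have h2' : -1 < z := by exact_mod_cast h2
  have : z = 0 := by omega
  simp [hz, this]

lemma eq_of_coe_Ico {x y : ℝ} (h : (x : Circle) = (y : Circle)) (hx : 0 ≤ x) (hx1 : x < 1)
    (hy : 0 ≤ y) (hy1 : y < 1) : x = y := by
  obtain ⟨z, hz⟩ := (coe_eq_iff _ _).1 h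
  have h1 : (z : ℝ) < 1 := by linarith
  have h2 : (-1 : ℝ) < z := by linarith
  have h1' : z < 1 := by exact_mod_cast h1
  have h2' : -1 < z := by exact_mod_cast h2
  have : z = 0 := by omega
  simp [hz, this]

lemma homeo_mul_apply {α : Type*} [TopologicalSpace α] (f g : α ≃ₜ α) (x : α) :
    (f * g) x = f (g x) := rfl
lemma homeo_one_apply {α : Type*} [TopologicalSpace α] (x : α) :
    (1 : α ≃ₜ α) x = x := rfl
lemma homeo_inv_apply {α : Type*} [TopologicalSpace α] (f : α ≃ₜ α) (x : α) :
    (f⁻¹) (f x) = x := f.symm_apply_apply x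
lemma homeo_apply_inv {α : Type*} [TopologicalSpace α] (f : α ≃ₜ α) (x : α) :
    f (f⁻¹ x) = x := f.apply_symm_apply x

/-- affine parametrisation of the standard interval of a word -/
def bt (n : ℕ) : List (Fin n) → ℝ → ℝ
  | [], s => s
  | d :: w, s => ((d : ℕ) + bt n w s) / n

lemma bt_append (n : ℕ) (v w : List (Fin n)) (s : ℝ) : bt n (v ++ w) s = bt n v (bt n w s) := by
  induction v with
  | nil => rfl
  | cons d v ih => simp [bt, ih]

lemma pos_of_word {n : ℕ} (d : Fin n) : (0 : ℝ) < n := by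
  exact_mod_cast (Nat.zero_le _).trans_lt d.2

lemma bt_int (n : ℕ) (w : List (Fin n)) :
    ∃ a : ℕ, a < n ^ w.length ∧ ∀ s, bt n w s = (a + s) / (n : ℝ) ^ w.length := by
  induction w with
  | nil => exact ⟨0, by simp, by simp [bt]⟩
  | cons d w ih =>
    obtain ⟨a, ha, h⟩ := ih
    have := pos_of_word d
    refine ⟨d * n ^ w.length + a, ?_, fun s => ?_⟩
    · have h1 : ((d : ℕ) + 1) * n ^ w.length ≤ n * n ^ w.length := Nat.mul_le_mul_right _ d.2
      rw [List.length_cons, pow_succ]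
      nlinarith
    · rw [bt, h, List.length_cons, pow_succ]
      push_cast
      field_simp
      ring

lemma bt_mem {n : ℕ} (w : List (Fin n)) {s : ℝ} (h0 : 0 ≤ s) (h1 : s ≤ 1) :
    0 ≤ bt n w s ∧ bt n w s ≤ 1 := by
  induction w with
  | nil => exact ⟨h0, h1⟩
  | cons d w ih =>
    have := pos_of_word d
    have hd : ((d : ℕ) : ℝ) + 1 ≤ n := by exact_mod_cast d.2
    simp only [bt]
    constructor
    · have := ih.1
      positivity
    · rw [div_le_one this]
      linarith [ih.2]

lemma bt_mem' {n : ℕ} (w : List (Fin n)) {s : ℝ} (h0 : 0 ≤ s) (h1 : s < 1) :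
    0 ≤ bt n w s ∧ bt n w s < 1 := by
  induction w with
  | nil => exact ⟨h0, h1⟩
  | cons d w ih =>
    have := pos_of_word d
    have hd : ((d : ℕ) : ℝ) + 1 ≤ n := by exact_mod_cast d.2
    simp only [bt]
    constructor
    · have := ih.1
      positivity
    · rw [div_lt_one this]
      linarith [ih.2]

lemma bt_affine {n : ℕ} (w : List (Fin n)) (s : ℝ) :
    bt n w s = bt n w 0 + s / (n : ℝ) ^ w.length := by
  obtain ⟨a, -, h⟩ := bt_int n w
  rw [h, h]; ring

lemma bt_prefix {n : ℕ} (v w : List (Fin n)) {x s : ℝ} (hx0 : 0 ≤ x) (hx1 : x < 1)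
    (hs0 : 0 ≤ s) (hs1 : s < 1) (hl : w.length ≤ v.length) (h : bt n v x = bt n w s) :
    ∃ v1, v = w ++ v1 := by
  induction w generalizing v with
  | nil => exact ⟨v, rfl⟩
  | cons d w ih =>
    cases v with
    | nil => simp at hl
    | cons e v =>
      have := pos_of_word d
      simp only [bt] at h
      have h' : ((e : ℕ) : ℝ) + bt n v x = (d : ℕ) + bt n w s := by
        field_simp at h; exact h
      have b1 := bt_mem' v hx0 hx1
      have b2 := bt_mem' w hs0 hs1
      have k1 : ((e : ℕ) : ℝ) < (d : ℕ) + 1 := by linarith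
      have k2 : ((d : ℕ) : ℝ) < (e : ℕ) + 1 := by linarith
      have k1' : (e : ℕ) < d + 1 := by exact_mod_cast k1
      have k2' : (d : ℕ) < e + 1 := by exact_mod_cast k2
      have hed : e = d := Fin.ext (by omega)
      subst hed
      obtain ⟨v1, hv⟩ := ih v (by simpa using hl) (by linarith)
      exact ⟨v1, by simp [hv]⟩

lemma bt_inj {n : ℕ} (hn : 2 ≤ n) (v w : List (Fin n))
    (h : ∀ s, 0 ≤ s → s ≤ 1 → ((bt n v s : ℝ) : Circle) = (bt n w s : ℝ)) : v = w := by
  have a1 := bt_mem' v (le_refl 0) one_pos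
  have a2 := bt_mem' w (le_refl 0) one_pos
  have e0 : bt n v 0 = bt n w 0 :=
    eq_of_coe_Ico (h 0 le_rfl zero_le_one) a1.1 a1.2 a2.1 a2.2
  have hn1 : (1 : ℝ) < n := by exact_mod_cast hn
  have hl : v.length = w.length := by
    have h1 := h 1 zero_le_one le_rfl
    rw [bt_affine v, bt_affine w, e0] at h1
    obtain ⟨z, hz⟩ := (coe_eq_iff _ _).1 h1
    have h2 : (((1 : ℝ) / (n : ℝ) ^ v.length : ℝ) : Circle) = ((1 / (n : ℝ) ^ w.length : ℝ)) :=
      (coe_eq_iff _ _).2 ⟨z, by linarith⟩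
    have h3 : (1 : ℝ) / (n : ℝ) ^ v.length = 1 / (n : ℝ) ^ w.length := by
      apply eq_of_coe_Ioc h2
      · positivity
      · rw [div_le_one (by positivity)]; exact one_le_pow₀ hn1.le
      · positivity
      · rw [div_le_one (by positivity)]; exact one_le_pow₀ hn1.le
    have h4 : (n : ℝ) ^ v.length = (n : ℝ) ^ w.length := by
      field_simp at h3; exact h3.symm
    exact (pow_right_injective₀ (by linarith) (by linarith)) h4
  obtain ⟨v1, hv⟩ := bt_prefix v w le_rfl one_pos le_rfl one_pos hl.ge e0
  rw [hv] at hl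
  have : v1 = [] := by
    simpa using hl
  simp [hv, this]

lemma bt_of_nat {n : ℕ} (hn : 2 ≤ n) (k : ℕ) (a : ℕ) (ha : a < n ^ k) :
    ∃ w : List (Fin n), w.length = k ∧ ∀ s, bt n w s = (a + s) / (n : ℝ) ^ k := by
  induction k generalizing a with
  | zero =>
    refine ⟨[], rfl, fun s => ?_⟩
    have : a = 0 := by simpa using ha
    simp [bt, this]
  | succ k ih =>
    have hp : 0 < n ^ k := by positivity
    obtain ⟨w, hw, h⟩ := ih (a % n ^ k) (Nat.mod_lt _ hp)
    refine ⟨⟨a / n ^ k, ?_⟩ :: w, by simp [hw], fun s => ?_⟩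
    · rw [Nat.div_lt_iff_lt_mul hp, ← pow_succ']; exact ha
    · have e : ((n ^ k * (a / n ^ k) + a % n ^ k : ℕ) : ℝ) = a := by
        rw [Nat.div_add_mod]
      push_cast at e
      have hn0 : (0 : ℝ) < n := by positivity
      simp only [bt, h]
      rw [← e]
      have : (n : ℝ) ^ k ≠ 0 := by positivity
      field_simp
      ring

lemma bt_of_int {n : ℕ} (hn : 2 ≤ n) (k : ℕ) (b : ℤ) :
    ∃ w : List (Fin n), w.length = k ∧ ∃ z : ℤ, ∀ s, ((b : ℝ) + s) / (n : ℝ) ^ k = bt n w s + z := by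
  have hp : (0 : ℤ) < (n : ℤ) ^ k := by positivity
  have h0 := Int.emod_nonneg b hp.ne'
  have h1 := Int.emod_lt_of_pos b hp
  obtain ⟨w, hw, h⟩ := bt_of_nat hn k (b % (n : ℤ) ^ k).toNat (by zify; rw [Int.toNat_of_nonneg h0]; exact h1)
  refine ⟨w, hw, b / (n : ℤ) ^ k, fun s => ?_⟩
  rw [h]
  have e : (((n : ℤ) ^ k * (b / (n : ℤ) ^ k) + b % (n : ℤ) ^ k : ℤ) : ℝ) = b := by
    rw [Int.mul_ediv_add_emod]
  have e2 : (((b % (n : ℤ) ^ k).toNat : ℕ) : ℝ) = ((b % (n : ℤ) ^ k : ℤ) : ℝ) := by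
    have := Int.toNat_of_nonneg h0
    exact_mod_cast this
  rw [e2, ← e]
  have : (n : ℝ) ^ k ≠ 0 := by positivity
  push_cast
  field_simp
  push_cast
  ring

lemma bt_cover {n : ℕ} (hn : 2 ≤ n) (K : ℕ) {x : ℝ} (h0 : 0 ≤ x) (h1 : x < 1) :
    ∃ w : List (Fin n), w.length = K ∧ ∃ s, 0 ≤ s ∧ s < 1 ∧ x = bt n w s := by
  have hp : (0 : ℝ) < (n : ℝ) ^ K := by positivity
  have hx : 0 ≤ x * (n : ℝ) ^ K := by positivity
  obtain ⟨w, hw, h⟩ := bt_of_nat hn K ⌊x * (n : ℝ) ^ K⌋₊ (by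
    rw [Nat.floor_lt hx]; push_cast; nlinarith)
  refine ⟨w, hw, x * (n : ℝ) ^ K - ⌊x * (n : ℝ) ^ K⌋₊, ?_, ?_, ?_⟩
  · linarith [Nat.floor_le hx]
  · linarith [Nat.lt_floor_add_one (x * (n : ℝ) ^ K)]
  · rw [h]; field_simp; ring

/-- the node `w` is mapped affinely to the node `w'` -/
def MapsW (n : ℕ) (f : Circle ≃ₜ Circle) (w w' : List (Fin n)) : Prop :=
  ∀ s : ℝ, 0 ≤ s → s ≤ 1 → f ((bt n w s : ℝ) : Circle) = ((bt n w' s : ℝ) : Circle)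

def Good (n : ℕ) (f : Circle ≃ₜ Circle) (w : List (Fin n)) : Prop := ∃ w', MapsW n f w w'

lemma MapsW.append {n : ℕ} {f : Circle ≃ₜ Circle} {w w' : List (Fin n)} (h : MapsW n f w w')
    (v : List (Fin n)) : MapsW n f (w ++ v) (w' ++ v) := by
  intro s h0 h1
  rw [bt_append, bt_append]
  have := bt_mem v h0 h1
  exact h _ this.1 this.2

lemma MapsW.comp {n : ℕ} {f g : Circle ≃ₜ Circle} {w w' w'' : List (Fin n)} (h : MapsW n f w w')
    (h' : MapsW n g w' w'') : MapsW n (g * f) w w'' := by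
  intro s h0 h1
  rw [homeo_mul_apply, h s h0 h1, h' s h0 h1]

lemma MapsW.inv {n : ℕ} {f : Circle ≃ₜ Circle} {w w' : List (Fin n)} (h : MapsW n f w w') :
    MapsW n f⁻¹ w' w := by
  intro s h0 h1
  rw [← h s h0 h1, homeo_inv_apply]

lemma MapsW.left_unique {n : ℕ} (hn : 2 ≤ n) {f : Circle ≃ₜ Circle} {w v w' : List (Fin n)}
    (h : MapsW n f w w') (h' : MapsW n f v w') : w = v := by
  apply bt_inj hn
  intro s h0 h1
  apply f.injective
  rw [h s h0 h1, h' s h0 h1]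

lemma MapsW.right_unique {n : ℕ} (hn : 2 ≤ n) {f : Circle ≃ₜ Circle} {w v w' : List (Fin n)}
    (h : MapsW n f w' w) (h' : MapsW n f w' v) : w = v := by
  apply bt_inj hn
  intro s h0 h1
  rw [← h s h0 h1, h' s h0 h1]

/-- all deep enough nodes are good -/
def EG (n : ℕ) (f : Circle ≃ₜ Circle) : Prop := ∃ K, ∀ w : List (Fin n), K ≤ w.length → Good n f w

lemma EG.one (n : ℕ) : EG n 1 := ⟨0, fun w _ => ⟨w, fun _ _ _ => rfl⟩⟩

lemma EG.mul {n : ℕ} {f g : Circle ≃ₜ Circle} (hf : EG n f) (hg : EG n g) : EG n (g * f) := by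
  obtain ⟨K, hK⟩ := hf
  obtain ⟨M, hM⟩ := hg
  refine ⟨K + M, fun w hw => ?_⟩
  obtain ⟨w', h'⟩ := hK (w.take K) (by simp; omega)
  obtain ⟨w'', h''⟩ := hM (w' ++ w.drop K) (by simp; omega)
  refine ⟨w'', ?_⟩
  have := (h'.append (w.drop K)).comp h''
  rwa [List.take_append_drop] at this

lemma EG.inv {n : ℕ} (hn : 2 ≤ n) {f : Circle ≃ₜ Circle} (hf : EG n f) : EG n f⁻¹ := by
  obtain ⟨K, hK⟩ := hf
  have hK' : ∀ w : List (Fin n), ∃ w', w.length = K → MapsW n f w w' := by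
    intro w
    by_cases h : w.length = K
    · obtain ⟨w', h'⟩ := hK w h.ge
      exact ⟨w', fun _ => h'⟩
    · exact ⟨[], fun h' => absurd h' h⟩
  choose im him using hK'
  have hfin : (Set.image (fun w => (im w).length) {w : List (Fin n) | w.length = K}).Finite :=
    (List.finite_length_eq (Fin n) K).image _
  obtain ⟨M, hM⟩ := hfin.bddAbove
  refine ⟨M, fun v hv => ?_⟩
  obtain ⟨p, hp⟩ : ∃ p, p = f⁻¹ ((bt n v 0 : ℝ) : Circle) := ⟨_, rfl⟩
  obtain ⟨x, hx⟩ := QuotientAddGroup.mk_surjective p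
  have hx' : ((Int.fract x : ℝ) : Circle) = p := by
    rw [← hx]; exact (coe_eq_iff _ _).2 ⟨-⌊x⌋, by push_cast; rw [Int.fract]; ring⟩
  obtain ⟨w, hw, s, hs0, hs1, hs⟩ := bt_cover hn K (Int.fract_nonneg x) (Int.fract_lt_one x)
  have hm := him w hw
  have e : ((bt n v 0 : ℝ) : Circle) = ((bt n (im w) s : ℝ) : Circle) := by
    rw [← hm s hs0 hs1.le, ← hs, hx', hp, homeo_apply_inv]
  have a1 := bt_mem' v le_rfl one_pos
  have a2 := bt_mem' (im w) hs0 hs1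
  have e' := eq_of_coe_Ico e a1.1 a1.2 a2.1 a2.2
  obtain ⟨v1, rfl⟩ := bt_prefix v (im w) le_rfl one_pos hs0 hs1
    ((hM ⟨w, hw, rfl⟩).trans hv) e'
  exact ⟨w ++ v1, hm.inv.append v1⟩

/-- degree one order isomorphism lift -/
def QL (f : Circle ≃ₜ Circle) : Prop :=
  ∃ P : ℝ ≃o ℝ, (∀ x, P (x + 1) = P x + 1) ∧ IsLift f P

lemma deg_one_int {P : ℝ → ℝ} (h : ∀ x, P (x + 1) = P x + 1) (x : ℝ) (z : ℤ) :
    P (x + z) = P x + z := by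
  induction z using Int.induction_on with
  | zero => simp
  | succ i ih => push_cast at *; rw [← add_assoc, h, ih]; ring
  | pred i ih =>
    push_cast at *
    have := h (x + (-i - 1))
    rw [show x + (-(i:ℝ) - 1) + 1 = x + -i by ring, ih] at this
    linarith

lemma QL.one : QL 1 := ⟨OrderIso.refl ℝ, fun _ => rfl, fun _ => rfl⟩

lemma QL.mul {f g : Circle ≃ₜ Circle} (hf : QL f) (hg : QL g) : QL (g * f) := by
  obtain ⟨P, hP, hf⟩ := hf
  obtain ⟨Q, hQ, hg⟩ := hg
  refine ⟨P.trans Q, fun x => ?_, fun x => ?_⟩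
  · simp [hP, hQ]
  · rw [homeo_mul_apply, hf, hg]; rfl

lemma QL.inv {f : Circle ≃ₜ Circle} (hf : QL f) : QL f⁻¹ := by
  obtain ⟨P, hP, hf⟩ := hf
  refine ⟨P.symm, fun x => ?_, fun x => ?_⟩
  · apply P.injective; simp [hP]
  · have := hf (P.symm x)
    rw [P.apply_symm_apply] at this
    rw [← this, homeo_inv_apply]

lemma QL.of_strictMono {f : Circle ≃ₜ Circle} {F : ℝ → ℝ} (hF : StrictMono F)
    (h1 : ∀ x, F (x + 1) = F x + 1) (hl : IsLift f F) : QL f := by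
  have hs : Function.Surjective F := by
    intro y
    obtain ⟨x, hx⟩ := QuotientAddGroup.mk_surjective (f⁻¹ ((y : ℝ) : Circle))
    have : ((F x : ℝ) : Circle) = (y : Circle) := by
      rw [← hl x]
      have : ((x : ℝ) : Circle) = f⁻¹ ((y : ℝ) : Circle) := hx
      rw [this, homeo_apply_inv]
    obtain ⟨z, hz⟩ := (coe_eq_iff _ _).1 this
    refine ⟨x + (-z : ℤ), ?_⟩
    rw [deg_one_int h1, hz]; push_cast; ring
  exact ⟨hF.orderIsoOfSurjective F hs, h1, hl⟩

/-- the lift on a good node -/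
lemma lift_good {n : ℕ} (hn : 2 ≤ n) {f : Circle ≃ₜ Circle} {P : ℝ ≃o ℝ}
    (hP : ∀ x, P (x + 1) = P x + 1) (hl : IsLift f P) {w w' : List (Fin n)}
    (h : MapsW n f w w') {s : ℝ} (h0 : 0 ≤ s) (h1 : s ≤ 1) :
    P (bt n w s) = P (bt n w 0) + s / (n : ℝ) ^ w'.length := by
  have hn1 : (1 : ℝ) < n := by exact_mod_cast hn
  rcases h0.eq_or_lt with rfl | h0'
  · simp
  have key : P (bt n w s) - P (bt n w 0) = s / (n : ℝ) ^ w'.length := by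
    have a1 : (1 : ℝ) ≤ (n : ℝ) ^ w.length := one_le_pow₀ hn1.le
    have a2 : (1 : ℝ) ≤ (n : ℝ) ^ w'.length := one_le_pow₀ hn1.le
    have e := bt_affine w s
    have p1 : 0 < s / (n : ℝ) ^ w.length := by positivity
    have p2 : s / (n : ℝ) ^ w.length ≤ 1 := by rw [div_le_one (by positivity)]; linarith
    apply eq_of_coe_Ioc
    · have k1 := h s h0 h1
      have k0 := h 0 le_rfl zero_le_one
      rw [hl] at k1 k0
      rw [bt_affine w' s] at k1
      obtain ⟨z1, hz1⟩ := (coe_eq_iff _ _).1 k1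
      obtain ⟨z0, hz0⟩ := (coe_eq_iff _ _).1 k0
      exact (coe_eq_iff _ _).2 ⟨z1 - z0, by push_cast; linarith⟩
    · have : P (bt n w 0) < P (bt n w s) := P.strictMono (by linarith)
      linarith
    · have : P (bt n w s) ≤ P (bt n w 0 + 1) := P.monotone (by linarith)
      rw [hP] at this
      linarith
    · positivity
    · rw [div_le_one (by positivity)]; linarith
  linarith

lemma find_idx (t : ℕ → ℝ) (m : ℕ) (x : ℝ) (h0 : t 0 ≤ x) (h1 : x < t m) :
    ∃ i, i < m ∧ t i ≤ x ∧ x < t (i + 1) := by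
  induction m with
  | zero => linarith
  | succ m ih =>
    by_cases h : x < t m
    · obtain ⟨i, hi, h⟩ := ih h
      exact ⟨i, by omega, h⟩
    · exact ⟨m, by omega, not_lt.1 h, h1⟩

lemma nadic_iff {n : ℕ} (hn : 2 ≤ n) (x : ℝ) :
    IsNAdic n x ↔ ∃ K : ℕ, ∀ k, K ≤ k → ∃ a : ℤ, x * (n : ℝ) ^ k = a := by
  have h0 : (n : ℝ) ≠ 0 := by positivity
  constructor
  · rintro ⟨a, K, rfl⟩
    refine ⟨K, fun k hk => ?_⟩
    obtain ⟨j, rfl⟩ := Nat.exists_eq_add_of_le hk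
    refine ⟨a * n ^ j, ?_⟩
    push_cast
    rw [pow_add]; field_simp
  · rintro ⟨K, h⟩
    obtain ⟨a, ha⟩ := h K le_rfl
    exact ⟨a, K, by rw [← ha]; field_simp⟩

lemma nadic_add {n : ℕ} (hn : 2 ≤ n) {x y : ℝ} (hx : IsNAdic n x) (hy : IsNAdic n y) :
    IsNAdic n (x + y) := by
  rw [nadic_iff hn] at *
  obtain ⟨K, hK⟩ := hx
  obtain ⟨M, hM⟩ := hy
  refine ⟨max K M, fun k hk => ?_⟩
  obtain ⟨a, ha⟩ := hK k (le_trans (le_max_left _ _) hk)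
  obtain ⟨b, hb⟩ := hM k (le_trans (le_max_right _ _) hk)
  exact ⟨a + b, by push_cast; rw [← ha, ← hb]; ring⟩

lemma nadic_mul {n : ℕ} {x y : ℝ} (hx : IsNAdic n x) (hy : IsNAdic n y) :
    IsNAdic n (x * y) := by
  obtain ⟨a, k, rfl⟩ := hx
  obtain ⟨b, l, rfl⟩ := hy
  exact ⟨a * b, k + l, by push_cast; rw [pow_add, div_mul_div_comm]⟩

lemma nadic_int {n : ℕ} (z : ℤ) : IsNAdic n (z : ℝ) := ⟨z, 0, by simp⟩

lemma nadic_zpow {n : ℕ} (z : ℤ) : IsNAdic n ((n : ℝ) ^ z) := by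
  obtain ⟨k, rfl | rfl⟩ := Int.eq_nat_or_neg z
  · exact ⟨n ^ k, 0, by simp⟩
  · exact ⟨1, k, by simp⟩

lemma nadic_neg {n : ℕ} {x : ℝ} (hx : IsNAdic n x) : IsNAdic n (-x) := by
  obtain ⟨a, k, rfl⟩ := hx
  exact ⟨-a, k, by push_cast; ring⟩

lemma nadic_bt {n : ℕ} (hn : 2 ≤ n) (w : List (Fin n)) (s : ℝ) :
    IsNAdic n (bt n w s) ↔ IsNAdic n s := by
  obtain ⟨a, -, h⟩ := bt_int n w
  have h0 : (n : ℝ) ≠ 0 := by positivity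
  rw [h]
  constructor
  · intro H
    have := nadic_add hn (nadic_mul H (nadic_zpow (w.length : ℤ))) (nadic_int (-a : ℤ))
    convert this using 1
    push_cast
    rw [zpow_natCast]
    field_simp
    ring
  · intro H
    have := nadic_mul (nadic_add hn (nadic_int (a : ℤ)) H) (nadic_zpow (-(w.length : ℤ)))
    convert this using 1
    rw [zpow_neg, zpow_natCast]
    push_cast
    rfl

lemma nadic_coe {n : ℕ} (hn : 2 ≤ n) (x : ℝ) : (x : Circle) ∈ nAdicPoints n ↔ IsNAdic n x := by
  constructor
  · rintro ⟨y, hy, h⟩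
    obtain ⟨z, rfl⟩ := (coe_eq_iff _ _).1 h
    exact nadic_add hn hy (nadic_int z)
  · intro h
    exact ⟨x, h, rfl⟩

lemma exists_fract_rep (p : Circle) : ∃ x : ℝ, 0 ≤ x ∧ x < 1 ∧ (x : Circle) = p := by
  obtain ⟨x, hx⟩ := QuotientAddGroup.mk_surjective p
  refine ⟨Int.fract x, Int.fract_nonneg x, Int.fract_lt_one x, ?_⟩
  rw [← hx]; exact (coe_eq_iff _ _).2 ⟨-⌊x⌋, by push_cast; rw [Int.fract]; ring⟩

lemma InT_of {n : ℕ} (hn : 2 ≤ n) {f : Circle ≃ₜ Circle} (hQ : QL f)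
    (m : ℕ) (t : ℕ → ℝ) (hm : 0 < m) (ht0 : t 0 = 0) (htm : t m = 1)
    (hinc : ∀ i, i < m → t i < t (i + 1))
    (h : ∀ i, i < m → ∃ w w' : List (Fin n), t i = bt n w 0 ∧ t (i + 1) = bt n w 1 ∧
      MapsW n f w w') : InT n f := by
  obtain ⟨P, hP, hl⟩ := hQ
  have hn0 : (0 : ℝ) < n := by positivity
  have hn0' : (n : ℝ) ≠ 0 := hn0.ne'
  have par : ∀ w : List (Fin n), ∀ x, bt n w 0 ≤ x → x ≤ bt n w 1 → ∃ s, 0 ≤ s ∧ s ≤ 1 ∧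
      x = bt n w s := by
    intro w x h0 h1
    have hp : (0 : ℝ) < (n : ℝ) ^ w.length := by positivity
    rw [bt_affine w 1] at h1
    refine ⟨(x - bt n w 0) * (n : ℝ) ^ w.length, by apply mul_nonneg <;> linarith, ?_, ?_⟩
    · have : x - bt n w 0 ≤ 1 / (n : ℝ) ^ w.length := by linarith
      rwa [le_div_iff₀ hp] at this
    · rw [bt_affine w ((x - bt n w 0) * (n : ℝ) ^ w.length)]; field_simp; ring
  have loc : ∀ x, 0 ≤ x → x < 1 → ∃ w w' : List (Fin n), ∃ s, 0 ≤ s ∧ s ≤ 1 ∧ x = bt n w s ∧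
      MapsW n f w w' := by
    intro x h0 h1
    obtain ⟨i, hi, hi0, hi1⟩ := find_idx t m x (by rw [ht0]; exact h0) (by rw [htm]; exact h1)
    obtain ⟨w, w', e0, e1, hw⟩ := h i hi
    obtain ⟨s, hs0, hs1, hs⟩ := par w x (e0 ▸ hi0) (e1 ▸ hi1.le)
    exact ⟨w, w', s, hs0, hs1, hs, hw⟩
  refine ⟨?_, P, P.strictMono, hl, hP, ?_⟩
  · ext p
    constructor
    · rintro ⟨q, hq, rfl⟩
      obtain ⟨x, h0, h1, rfl⟩ := exists_fract_rep q
      rw [nadic_coe hn] at hq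
      obtain ⟨w, w', s, hs0, hs1, rfl, hw⟩ := loc x h0 h1
      rw [hw s hs0 hs1, nadic_coe hn, nadic_bt hn]
      rwa [nadic_bt hn] at hq
    · intro hp
      obtain ⟨x, h0, h1, hx⟩ := exists_fract_rep (f⁻¹ p)
      refine ⟨x, ?_, by rw [hx, homeo_apply_inv]⟩
      have hx' : f x = p := by rw [hx, homeo_apply_inv]
      obtain ⟨w, w', s, hs0, hs1, rfl, hw⟩ := loc x h0 h1
      rw [← hx', hw s hs0 hs1, nadic_coe hn, nadic_bt hn] at hp
      rwa [nadic_coe hn, nadic_bt hn]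
  · have hch : ∀ i, ∃ z : ℤ, i < m → ∀ x ∈ Set.Icc (t i) (t (i + 1)),
        P x = (n : ℝ) ^ z * x + (P (t i) - (n : ℝ) ^ z * t i) := by
      intro i
      by_cases hi : i < m
      · obtain ⟨w, w', e0, e1, hw⟩ := h i hi
        refine ⟨(w.length : ℤ) - w'.length, fun _ x hx => ?_⟩
        rw [e0, e1] at hx
        obtain ⟨s, hs0, hs1, rfl⟩ := par w x hx.1 hx.2
        rw [lift_good hn hP hl hw hs0 hs1, e0, bt_affine w s, zpow_sub₀ hn0', zpow_natCast,
          zpow_natCast]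
        field_simp
        ring
      · exact ⟨0, fun h => absurd h hi⟩
    choose sl hsl using hch
    refine ⟨m, t, sl, fun i => P (t i) - (n : ℝ) ^ (sl i) * t i, hm, ht0, htm, hinc, ?_, hsl⟩
    intro i hi
    rcases hi.eq_or_lt with rfl | hi
    · rw [htm]; exact_mod_cast nadic_int (n := n) 1
    · obtain ⟨w, w', e0, e1, hw⟩ := h i hi
      rw [e0, nadic_bt hn]; exact_mod_cast nadic_int (n := n) 0

lemma EG_of_InT {n : ℕ} (hn : 2 ≤ n) {f : Circle ≃ₜ Circle} (hf : InT n f) : EG n f := by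
  obtain ⟨him, F, hF, hl, hF1, m, t, sl, c, hm, ht0, htm, hinc, hnad, haff⟩ := hf
  have hn0 : (0 : ℝ) < n := by positivity
  have hn0' : (n : ℝ) ≠ 0 := hn0.ne'
  have hFn : ∀ x, IsNAdic n x → IsNAdic n (F x) := by
    intro x hx
    rw [← nadic_coe hn, ← hl, ← him]
    exact ⟨_, (nadic_coe hn x).2 hx, rfl⟩
  have hc : ∀ i, i < m → IsNAdic n (c i) := by
    intro i hi
    have e := haff i hi (t i) ⟨le_rfl, (hinc i hi).le⟩
    have : c i = F (t i) + -((n : ℝ) ^ sl i * t i) := by linarith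
    rw [this]
    exact nadic_add hn (hFn _ (hnad i hi.le)) (nadic_neg (nadic_mul (nadic_zpow _) (hnad i hi.le)))
  have hev : ∀ᶠ K : ℕ in Filter.atTop, ∀ i ∈ {i | i < m},
      (∀ k, K ≤ k → ∃ a : ℤ, c i * (n : ℝ) ^ k = a) ∧
      (∀ k, K ≤ k → ∃ a : ℤ, t (i + 1) * (n : ℝ) ^ k = a) ∧ sl i ≤ K := by
    rw [Filter.eventually_all_finite (Set.finite_lt_nat m)]
    intro i hi
    obtain ⟨K1, h1⟩ := (nadic_iff hn _).1 (hc i hi)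
    obtain ⟨K2, h2⟩ := (nadic_iff hn _).1 (hnad (i + 1) hi)
    filter_upwards [Filter.eventually_ge_atTop K1, Filter.eventually_ge_atTop K2,
      Filter.eventually_ge_atTop (sl i).toNat] with K e1 e2 e3
    exact ⟨fun k hk => h1 k (e1.trans hk), fun k hk => h2 k (e2.trans hk), by omega⟩
  obtain ⟨K, hK⟩ := hev.exists
  refine ⟨2 * K, fun w hw => ?_⟩
  obtain ⟨a, ha, hbt⟩ := bt_int n w
  set k := w.length with hk
  have hp : (0 : ℝ) < (n : ℝ) ^ k := by positivity
  have b := bt_mem' w le_rfl one_pos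
  obtain ⟨i, hi, hi0, hi1⟩ := find_idx t m (bt n w 0) (by rw [ht0]; exact b.1) (by rw [htm]; exact b.2)
  obtain ⟨hc', ht', hs'⟩ := hK i hi
  obtain ⟨T, hT⟩ := ht' k (by omega)
  obtain ⟨l, hl'⟩ : ∃ l : ℕ, (l : ℤ) = k - sl i := ⟨((k : ℤ) - sl i).toNat, by omega⟩
  obtain ⟨C, hC⟩ := hc' l (by omega)
  have hend : ((a : ℝ) + 1) / (n : ℝ) ^ k ≤ t (i + 1) := by
    rw [hbt, div_lt_iff₀ hp, hT] at hi1
    rw [div_le_iff₀ hp, hT]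
    have : (a : ℤ) < T := by simp at hi1; exact_mod_cast hi1
    exact_mod_cast this
  obtain ⟨w', hw', z, hz⟩ := bt_of_int hn l (a + C)
  refine ⟨w', fun s h0 h1 => ?_⟩
  rw [hl, coe_eq_iff]
  refine ⟨z, ?_⟩
  rw [← hz, haff i hi]
  · have e : (n : ℝ) ^ sl i = (n : ℝ) ^ k / (n : ℝ) ^ l := by
      rw [← zpow_natCast, ← zpow_natCast, hl', ← zpow_sub₀ hn0']; congr 1; ring
    have hpl : (0 : ℝ) < (n : ℝ) ^ l := by positivity
    have hcc : c i = C / (n : ℝ) ^ l := by rw [← hC]; field_simp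
    rw [e, hbt, hcc]; push_cast; field_simp; ring
  · rw [hbt] at hi0 ⊢
    constructor
    · refine hi0.trans ?_
      gcongr
    · refine le_trans ?_ hend
      gcongr

lemma Tn_props {n : ℕ} (hn : 2 ≤ n) {f : Circle ≃ₜ Circle} (hf : f ∈ Tn n) : EG n f ∧ QL f := by
  induction hf using Subgroup.closure_induction with
  | mem f hf =>
    refine ⟨EG_of_InT hn hf, ?_⟩
    obtain ⟨-, F, hF, hl, hF1, -⟩ := hf
    exact QL.of_strictMono hF hF1 hl
  | one => exact ⟨EG.one n, QL.one⟩
  | mul f g _ _ h1 h2 => exact ⟨EG.mul h2.1 h1.1, QL.mul h2.2 h1.2⟩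
  | inv f _ h => exact ⟨EG.inv hn h.1, QL.inv h.2⟩

/-! complexity -/

def Bad (n : ℕ) (f : Circle ≃ₜ Circle) : Set (List (Fin n)) := {w | ¬ Good n f w}

lemma Bad_finite {n : ℕ} {f : Circle ≃ₜ Circle} (h : EG n f) : (Bad n f).Finite := by
  obtain ⟨K, hK⟩ := h
  apply (List.finite_length_lt (Fin n) K).subset
  intro w hw
  by_contra h
  exact hw (hK w (not_lt.1 h))

def cpx (n : ℕ) (f : Circle ≃ₜ Circle) : ℕ := (Bad n f).ncard

lemma cpx_mul {n : ℕ} (hn : 2 ≤ n) {f g : Circle ≃ₜ Circle} (hf : EG n f) (hg : EG n g) :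
    cpx n (g * f) ≤ cpx n g + cpx n f := by
  classical
  have hch : ∀ w, ∃ w', Good n f w → MapsW n f w w' := by
    intro w
    by_cases h : Good n f w
    · obtain ⟨w', h'⟩ := h
      exact ⟨w', fun _ => h'⟩
    · exact ⟨[], fun h' => absurd h' h⟩
  choose im him using hch
  have hsub : Bad n (g * f) ⊆ {w | Good n f w ∧ im w ∈ Bad n g} ∪ Bad n f := by
    intro w hw
    by_cases h : Good n f w
    · left
      refine ⟨h, fun ⟨w'', h''⟩ => hw ⟨w'', (him w h).comp h''⟩⟩
    · right; exact h
  have hinj : Set.InjOn im {w | Good n f w ∧ im w ∈ Bad n g} := by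
    intro w hw v hv e
    have h1 := him w hw.1
    have h2 := him v hv.1
    rw [← e] at h2
    exact h1.left_unique hn h2
  have himg : im '' {w | Good n f w ∧ im w ∈ Bad n g} ⊆ Bad n g := by
    rintro _ ⟨w, hw, rfl⟩
    exact hw.2
  have hfin : {w | Good n f w ∧ im w ∈ Bad n g}.Finite :=
    Set.Finite.of_finite_image ((Bad_finite hg).subset himg) hinj
  calc cpx n (g * f) ≤ ({w | Good n f w ∧ im w ∈ Bad n g} ∪ Bad n f).ncard :=
        Set.ncard_le_ncard hsub (hfin.union (Bad_finite hf))
    _ ≤ _ := Set.ncard_union_le _ _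
    _ ≤ _ := by
        refine Nat.add_le_add ?_ le_rfl
        rw [← Set.ncard_image_of_injOn hinj]
        exact Set.ncard_le_ncard himg (Bad_finite hg)

lemma cpx_one (n : ℕ) : cpx n 1 = 0 := by
  have : Bad n 1 = ∅ := by
    ext w; simp only [Bad, Set.mem_setOf_eq, Set.mem_empty_iff_false, iff_false, not_not]
    exact ⟨w, fun _ _ _ => rfl⟩
  simp [cpx, this]

lemma mono_of_inc {t : ℕ → ℝ} {N : ℕ} (h : ∀ i, i < N → t i < t (i + 1)) {i j : ℕ} (hij : i ≤ j)
    (hj : j ≤ N) : t i ≤ t j := by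
  induction j, hij using Nat.le_induction with
  | base => exact le_rfl
  | succ k hk ih => exact (ih (by omega)).trans (h k (by omega)).le

lemma smono_of_inc {t : ℕ → ℝ} {N : ℕ} (h : ∀ i, i < N → t i < t (i + 1)) {i j : ℕ} (hij : i < j)
    (hj : j ≤ N) : t i < t j :=
  (h i (by omega)).trans_le (mono_of_inc h (by omega : i + 1 ≤ j) hj)

/-- length of `[0,x]` inside the periodised interval `[a,b]` -/
def lam (a b x : ℝ) : ℝ := ⌊x⌋ * (b - a) + (min (Int.fract x) b - min (Int.fract x) a)

lemma min_diff_mono {a b x y : ℝ} (hab : a ≤ b) (hxy : x ≤ y) :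
    min x b - min x a ≤ min y b - min y a := by
  rcases le_total x a with h1 | h1 <;> rcases le_total x b with h2 | h2 <;>
  rcases le_total y a with h3 | h3 <;> rcases le_total y b with h4 | h4 <;>
  simp [h1, h2, h3, h4] <;> linarith

lemma lam_mono {a b x y : ℝ} (hab : a ≤ b) (hxy : x ≤ y) : lam a b x ≤ lam a b y := by
  unfold lam
  rcases (Int.floor_mono hxy).eq_or_lt with h | h
  · have : Int.fract x ≤ Int.fract y := by
      simp only [Int.fract]; rw [h]; linarith
    rw [h]
    linarith [min_diff_mono hab this]
  · have h' : (⌊x⌋ : ℝ) + 1 ≤ ⌊y⌋ := by exact_mod_cast h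
    have b1 : ∀ z : ℝ, 0 ≤ min z b - min z a := fun z => by
      have := min_le_min_left z hab; linarith
    have b2 : ∀ z : ℝ, min z b - min z a ≤ b - a := fun z => by
      rcases le_total z a with h1 | h1 <;> rcases le_total z b with h2 | h2 <;>
      simp [h1, h2] <;> linarith
    nlinarith [b1 (Int.fract y), b2 (Int.fract x)]

lemma lam_unit {a b x : ℝ} (ha : 0 ≤ a) (hb : 0 ≤ b) (hb1 : b ≤ 1) (hab : a ≤ b)
    (h0 : 0 ≤ x) (h1 : x ≤ 1) : lam a b x = min x b - min x a := by
  unfold lam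
  rcases h1.eq_or_lt with rfl | h1
  · simp [ha, hb, hb1, hab.trans hb1]
  · rw [Int.floor_eq_zero_iff.2 ⟨h0, h1⟩, Int.fract_eq_self.2 ⟨h0, h1⟩]; simp

lemma lam_add_one (a b x : ℝ) : lam a b (x + 1) = lam a b x + (b - a) := by
  unfold lam
  rw [Int.floor_add_one, Int.fract_add_one]; push_cast; ring

lemma exists_PL (N : ℕ) (t u : ℕ → ℝ) (ht0 : t 0 = 0) (htN : t N = 1)
    (ht : ∀ i, i < N → t i < t (i + 1)) (hu0 : u 0 = 0) (huN : u N = 1)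
    (hu : ∀ i, i < N → u i < u (i + 1)) :
    ∃ P : ℝ ≃o ℝ, (∀ x, P (x + 1) = P x + 1) ∧
      (∀ i, i < N → ∀ s, 0 ≤ s → s ≤ 1 →
        P (t i + s * (t (i + 1) - t i)) = u i + s * (u (i + 1) - u i)) ∧
      ∀ C : ℝ, (∀ i, i < N → u (i + 1) - u i ≤ C * (t (i + 1) - t i)) →
        ∀ x y, x ≤ y → P y - P x ≤ C * (y - x) := by
  classical
  have hpos : ∀ i, i < N → 0 < t (i + 1) - t i := fun i hi => by linarith [ht i hi]
  have hposu : ∀ i, i < N → 0 < u (i + 1) - u i := fun i hi => by linarith [hu i hi]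
  have htge : ∀ i, i ≤ N → 0 ≤ t i := fun i hi => ht0 ▸ mono_of_inc ht (Nat.zero_le i) hi
  have htle : ∀ i, i ≤ N → t i ≤ 1 := fun i hi => htN ▸ mono_of_inc ht hi le_rfl
  have hsum : ∀ x, ∑ i ∈ Finset.range N, lam (t i) (t (i + 1)) x = x := by
    intro x
    simp only [lam]
    rw [Finset.sum_add_distrib, ← Finset.mul_sum, Finset.sum_range_sub,
      Finset.sum_range_sub (fun i => min (Int.fract x) (t i)), ht0, htN,
      min_eq_left (Int.fract_lt_one x).le, min_eq_right (Int.fract_nonneg x)]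
    simp
  let sl : ℕ → ℝ := fun i => (u (i + 1) - u i) / (t (i + 1) - t i)
  have hsl : ∀ i, i < N → 0 < sl i := fun i hi => div_pos (hposu i hi) (hpos i hi)
  let F : ℝ → ℝ := fun x => ∑ i ∈ Finset.range N, sl i * lam (t i) (t (i + 1)) x
  have hdiff : ∀ x y, F y - F x = ∑ i ∈ Finset.range N,
      sl i * (lam (t i) (t (i + 1)) y - lam (t i) (t (i + 1)) x) := by
    intro x y
    simp only [F]
    rw [← Finset.sum_sub_distrib]
    exact Finset.sum_congr rfl fun i _ => by ring
  have hdl : ∀ x y, x ≤ y → ∀ i, i < N → 0 ≤ lam (t i) (t (i + 1)) y - lam (t i) (t (i + 1)) x :=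
    fun x y hxy i hi => by linarith [lam_mono (ht i hi).le hxy]
  have hsd : ∀ x y, ∑ i ∈ Finset.range N,
      (lam (t i) (t (i + 1)) y - lam (t i) (t (i + 1)) x) = y - x := by
    intro x y
    rw [Finset.sum_sub_distrib, hsum, hsum]
  have hF1 : ∀ x, F (x + 1) = F x + 1 := by
    intro x
    have : F (x + 1) - F x = 1 := by
      rw [hdiff]
      calc _ = ∑ i ∈ Finset.range N, (u (i + 1) - u i) := by
            refine Finset.sum_congr rfl fun i hi => ?_
            have := hpos i (Finset.mem_range.1 hi)
            rw [lam_add_one]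
            simp only [sl]
            field_simp
            ring
        _ = 1 := by rw [Finset.sum_range_sub, hu0, huN]; ring
    linarith
  have hlip : ∀ C : ℝ, (∀ i, i < N → u (i + 1) - u i ≤ C * (t (i + 1) - t i)) →
        ∀ x y, x ≤ y → F y - F x ≤ C * (y - x) := by
    intro C hC x y hxy
    rw [hdiff, ← hsd x y, Finset.mul_sum]
    refine Finset.sum_le_sum fun i hi => ?_
    have hi := Finset.mem_range.1 hi
    refine mul_le_mul_of_nonneg_right ?_ (hdl x y hxy i hi)
    simp only [sl]
    rw [div_le_iff₀ (hpos i hi)]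
    exact hC i hi
  have hmono : StrictMono F := by
    intro x y hxy
    have : 0 < F y - F x := by
      rw [hdiff]
      by_contra hcon
      have hz : ∀ i ∈ Finset.range N,
          sl i * (lam (t i) (t (i + 1)) y - lam (t i) (t (i + 1)) x) = 0 := by
        have hnn : ∀ i ∈ Finset.range N,
            0 ≤ sl i * (lam (t i) (t (i + 1)) y - lam (t i) (t (i + 1)) x) := fun i hi =>
          mul_nonneg (hsl i (Finset.mem_range.1 hi)).le (hdl x y hxy.le i (Finset.mem_range.1 hi))
        exact (Finset.sum_eq_zero_iff_of_nonneg hnn).1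
          (le_antisymm (not_lt.1 hcon) (Finset.sum_nonneg hnn))
      have : y - x = 0 := by
        rw [← hsd x y]
        refine Finset.sum_eq_zero fun i hi => ?_
        have h1 := hz i hi
        have h2 := hsl i (Finset.mem_range.1 hi)
        rcases mul_eq_zero.1 h1 with h | h
        · linarith
        · exact h
      linarith
    linarith
  have hval : ∀ j, j < N → ∀ s, 0 ≤ s → s ≤ 1 →
        F (t j + s * (t (j + 1) - t j)) = u j + s * (u (j + 1) - u j) := by
    intro j hj s hs0 hs1
    have hdj := hpos j hj
    set x := t j + s * (t (j + 1) - t j) with hx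
    have hxj : t j ≤ x := by rw [hx]; nlinarith
    have hxj1 : x ≤ t (j + 1) := by rw [hx]; nlinarith
    have key : ∀ k, k ≤ N → ∑ i ∈ Finset.range k, sl i * lam (t i) (t (i + 1)) x =
        if k ≤ j then u k else u j + s * (u (j + 1) - u j) := by
      intro k
      induction k with
      | zero => intro _; simp [hu0]
      | succ k ih =>
        intro hk
        have hk' : k < N := hk
        have hdk := hpos k hk'
        rw [Finset.sum_range_succ, ih hk'.le, lam_unit (htge k hk'.le) (htge _ hk)
          (htle _ hk) (ht k hk').le ((htge j hj.le).trans hxj) (hxj1.trans (htle _ hj))]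
        rcases lt_trichotomy k j with h | h | h
        · have h1 : t (k + 1) ≤ x := (mono_of_inc ht h hj.le).trans hxj
          rw [if_pos h.le, if_pos (by omega), min_eq_right h1, min_eq_right (by linarith)]
          simp only [sl]
          field_simp
          ring
        · subst h
          rw [if_pos le_rfl, if_neg (by omega), min_eq_left hxj1, min_eq_right hxj, hx]
          simp only [sl]
          field_simp
          ring
        · have h1 : x ≤ t k := hxj1.trans (mono_of_inc ht h hk'.le)
          rw [if_neg (by omega), if_neg (by omega), min_eq_left h1, min_eq_left (by linarith)]
          ring
    have := key N le_rfl
    rw [if_neg (by omega)] at this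
    exact this
  have hN : 0 < N := by
    rcases Nat.eq_zero_or_pos N with h | h
    · subst h; rw [ht0] at htN; norm_num at htN
    · exact h
  have hF0 : F 0 = 0 := by
    have := hval 0 hN 0 le_rfl zero_le_one
    simpa [ht0, hu0] using this
  have hcont : Continuous F := by
    let C : ℝ := ∑ i ∈ Finset.range N, sl i
    have hC : ∀ i, i < N → u (i + 1) - u i ≤ C * (t (i + 1) - t i) := by
      intro i hi
      rw [← div_le_iff₀ (hpos i hi)]
      exact Finset.single_le_sum (f := sl) (fun i hi => (hsl i (Finset.mem_range.1 hi)).le)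
        (Finset.mem_range.2 hi)
    have hC0 : 0 ≤ C := Finset.sum_nonneg (fun i hi => (hsl i (Finset.mem_range.1 hi)).le)
    have : LipschitzWith ⟨C, hC0⟩ F := by
      apply LipschitzWith.of_dist_le_mul
      intro x y
      change |F x - F y| ≤ C * |x - y|
      rcases le_total x y with h | h
      · rw [abs_sub_comm, abs_of_nonneg (by linarith [hmono.monotone h]), abs_sub_comm x,
          abs_of_nonneg (by linarith : 0 ≤ y - x)]
        exact hlip C hC x y h
      · rw [abs_of_nonneg (by linarith [hmono.monotone h]),
          abs_of_nonneg (by linarith : 0 ≤ x - y)]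
        exact hlip C hC y x h
    exact this.continuous
  have hint : ∀ z : ℤ, F z = z := fun z => by
    have := deg_one_int hF1 0 z
    rw [zero_add, hF0, zero_add] at this
    exact this
  have hsurj : Function.Surjective F := by
    intro y
    have h1 : (⌊y⌋ : ℝ) ≤ ⌊y⌋ + 1 := by linarith
    have := intermediate_value_Icc h1 hcont.continuousOn
    rw [hF1, hint] at this
    obtain ⟨x, -, hx⟩ := this ⟨Int.floor_le y, (Int.lt_floor_add_one y).le⟩
    exact ⟨x, hx⟩
  exact ⟨hmono.orderIsoOfSurjective F hsurj, hF1, hval, hlip⟩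

/-- circle homeomorphism from a degree one order isomorphism -/
lemma exists_homeo (P : ℝ ≃o ℝ) (hP : ∀ x, P (x + 1) = P x + 1) :
    ∃ f : Circle ≃ₜ Circle, IsLift f P := by
  have hPs : ∀ x, P.symm (x + 1) = P.symm x + 1 := fun x => by
    apply P.injective; simp [hP]
  have wd : ∀ Q : ℝ ≃o ℝ, (∀ x, Q (x + 1) = Q x + 1) → ∃ g : Circle → Circle, Continuous g ∧
      ∀ x : ℝ, g x = ((Q x : ℝ) : Circle) := by
    intro Q hQ
    refine ⟨Quotient.lift (fun x : ℝ => ((Q x : ℝ) : Circle)) ?_, ?_, fun x => rfl⟩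
    · intro a b hab
      have : (a : Circle) = (b : Circle) := Quotient.sound hab
      obtain ⟨z, rfl⟩ := (coe_eq_iff _ _).1 this
      change ((Q (b + z) : ℝ) : Circle) = _
      rw [deg_one_int hQ]
      exact coe_add_int _ _
    · apply Continuous.quotient_lift
      exact (AddCircle.continuous_mk' 1).comp Q.continuous
  obtain ⟨g, hg, hg'⟩ := wd P hP
  obtain ⟨k, hk, hk'⟩ := wd P.symm hPs
  refine ⟨⟨⟨g, k, fun p => ?_, fun p => ?_⟩, hg, hk⟩, hg'⟩
  · obtain ⟨x, rfl⟩ := QuotientAddGroup.mk_surjective p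
    change k (g (x : Circle)) = _
    rw [hg', hk']; simp
  · obtain ⟨x, rfl⟩ := QuotientAddGroup.mk_surjective p
    change g (k (x : Circle)) = _
    rw [hk', hg']; simp

lemma deg1_bdd {r : ℝ → ℝ} (hr : Monotone r) (h1 : ∀ x, r (x + 1) = r x + 1) (x : ℝ) :
    |r x - x| ≤ |r 0| + 1 := by
  have e := deg_one_int h1 0 ⌊x⌋
  rw [zero_add] at e
  have e1 := hr (Int.floor_le x)
  have e2 := hr (Int.lt_floor_add_one x).le
  rw [h1] at e2
  rw [e] at e1 e2
  have k1 := Int.floor_le x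
  have k2 := Int.lt_floor_add_one x
  have k3 := le_abs_self (r 0)
  have k4 := neg_abs_le (r 0)
  rw [abs_le]
  constructor <;> linarith

lemma deg1_nat {r : ℝ → ℝ} (h1 : ∀ x, r (x + 1) = r x + 1) (x : ℝ) (k : ℕ) :
    r (x + k) = r x + k := by
  have := deg_one_int h1 x k
  exact_mod_cast this

lemma abs_lip {p : ℝ → ℝ} (hp : Monotone p) (hl : ∀ x y, x ≤ y → p y - p x ≤ (y - x) / 2)
    (x y : ℝ) : |p x - p y| ≤ |x - y| / 2 := by
  rcases le_total x y with h | h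
  · rw [abs_sub_comm, abs_of_nonneg (by linarith [hp h]), abs_sub_comm x,
          abs_of_nonneg (by linarith : 0 ≤ y - x)]
    exact hl x y h
  · rw [abs_of_nonneg (by linarith [hp h]), abs_of_nonneg (by linarith : 0 ≤ x - y)]
    exact hl y x h

lemma abs_lip_iter {p : ℝ → ℝ} (hp : ∀ x y, |p x - p y| ≤ |x - y| / 2) (k : ℕ)
    (x y : ℝ) : |p^[k] x - p^[k] y| ≤ |x - y| / 2 ^ k := by
  induction k with
  | zero => simp
  | succ k ih =>
    rw [Function.iterate_succ_apply', Function.iterate_succ_apply', pow_succ]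
    refine (hp _ _).trans ?_
    rw [← div_div]
    linarith

lemma exists_semi (n : ℕ) (p q : ℝ → ℝ) (hp : Monotone p)
    (hl : ∀ x y, x ≤ y → p y - p x ≤ (y - x) / 2) (hpn : ∀ x, p (x + n) = p x + 1)
    (hq : Monotone q) (hqn : ∀ x, q (x + 1) = q x + n) :
    ∃ u : ℝ → ℝ, Monotone u ∧ (∀ x, u (x + 1) = u x + 1) ∧ ∀ x, u x = p (u (q x)) := by
  have hl' := abs_lip hp hl
  let U : ℕ → ℝ → ℝ := fun k x => p^[k] (q^[k] x)
  have hU : ∀ k x, U (k + 1) x = p (U k (q x)) := by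
    intro k x
    simp only [U]
    rw [Function.iterate_succ_apply' p, Function.iterate_succ_apply q]
  have hU1 : ∀ k x, U k (x + 1) = U k x + 1 := by
    intro k
    induction k with
    | zero => intro x; rfl
    | succ k ih => intro x; rw [hU, hU, hqn, deg1_nat ih, hpn]
  have hUm : ∀ k, Monotone (U k) := fun k => (hp.iterate k).comp (hq.iterate k)
  have hb := deg1_bdd (r := fun x => p (q x)) (hp.comp hq) (fun x => by rw [hqn, hpn])
  set C := |p (q 0)| + 1 with hC
  have hd : ∀ x k, dist (U k x) (U (k + 1) x) ≤ (2 * C) / 2 / 2 ^ k := by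
    intro x k
    simp only [U]
    rw [Function.iterate_succ_apply p, Function.iterate_succ_apply' q, Real.dist_eq]
    refine (abs_lip_iter hl' k _ _).trans ?_
    rw [abs_sub_comm]
    have := hb (q^[k] x)
    have h2 : (2 * C) / 2 = C := by ring
    rw [h2]
    gcongr
  have hlim : ∀ x, ∃ y, Filter.Tendsto (fun k => U k x) Filter.atTop (nhds y) := fun x =>
    cauchySeq_tendsto_of_complete (cauchySeq_of_le_geometric_two (hd x))
  choose u hu using hlim
  have hpc : Continuous p := by
    have : LipschitzWith (1/2 : NNReal) p := by
      apply LipschitzWith.of_dist_le_mul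
      intro x y
      have := hl' x y
      rw [Real.dist_eq, Real.dist_eq]
      push_cast
      linarith
    exact this.continuous
  refine ⟨u, fun x y hxy => ?_, fun x => ?_, fun x => ?_⟩
  · exact le_of_tendsto_of_tendsto' (hu x) (hu y) (fun k => hUm k hxy)
  · refine tendsto_nhds_unique (hu (x + 1)) ?_
    simp only [hU1]
    exact (hu x).add_const 1
  · refine tendsto_nhds_unique ((Filter.tendsto_add_atTop_iff_nat 1).2 (hu x)) ?_
    simp only [hU]
    exact (hpc.tendsto _).comp (hu (q x))

lemma semi_unique {p q v : ℝ → ℝ} (hl : ∀ x y, |p x - p y| ≤ |x - y| / 2)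
    (hpq : ∀ x, p (q x) = x) (hv : Monotone v) (hv1 : ∀ x, v (x + 1) = v x + 1)
    (hvv : ∀ x, v x = p (v (q x))) (x : ℝ) : v x = x := by
  have hb := deg1_bdd hv hv1
  have hk : ∀ k : ℕ, ∀ x, |v x - x| ≤ (|v 0| + 1) * (1 / 2) ^ k := by
    intro k
    induction k with
    | zero => intro x; simpa using hb x
    | succ k ih =>
      intro x
      have h1 := hl (v (q x)) (q x)
      rw [← hvv, hpq] at h1
      have h2 := ih (q x)
      rw [pow_succ]
      linarith
  have ht : Filter.Tendsto (fun k : ℕ => (|v 0| + 1) * (1 / 2 : ℝ) ^ k) Filter.atTop (nhds 0) := by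
    have := (tendsto_pow_atTop_nhds_zero_of_lt_one (by norm_num : (0:ℝ) ≤ 1/2) (by norm_num)).const_mul (|v 0| + 1)
    simpa using this
  have : |v x - x| ≤ 0 := ge_of_tendsto' ht (fun k => hk k x)
  have := abs_nonpos_iff.1 this
  linarith

def bn (n : ℕ) (j : ℕ) : ℝ := if j < n then 1 - (1 / 2) ^ j else 1

lemma exists_H {n : ℕ} (hn : 2 ≤ n) : ∃ H : ℝ ≃o ℝ, (∀ x, H (x + 1) = H x + 1) ∧ H 0 = 0 ∧
    ∀ d, d < n → ∀ s, 0 ≤ s → s ≤ 1 →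
      H ((d + s) / n) = bn n d + H s * (bn n (d + 1) - bn n d) := by
  have hn0 : (0 : ℝ) < n := by positivity
  have hn2 : (2 : ℝ) ≤ n := by exact_mod_cast hn
  have hbd : ∀ i, i < n → bn n i < bn n (i + 1) ∧ bn n (i + 1) - bn n i ≤ 1 / 2 := by
    intro i hi
    have hp : (0 : ℝ) < (1 / 2) ^ i := by positivity
    have hp1 : ((1 : ℝ) / 2) ^ i ≤ 1 := pow_le_one₀ (by norm_num) (by norm_num)
    unfold bn
    rw [if_pos hi]
    by_cases h : i + 1 < n
    · rw [if_pos h, pow_succ]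
      constructor <;> linarith
    · rw [if_neg h]
      obtain ⟨k, rfl⟩ : ∃ k, i = k + 1 := ⟨i - 1, by omega⟩
      have hp1 : ((1 : ℝ) / 2) ^ k ≤ 1 := pow_le_one₀ (by norm_num) (by norm_num)
      rw [pow_succ] at *
      constructor <;> linarith
  obtain ⟨P, hP1, hPv, hPl⟩ := exists_PL n (fun j => (j : ℝ) / n) (bn n) (by simp)
    (by field_simp) (fun i hi => by push_cast; gcongr; linarith)
    (by simp only [bn]; rw [if_pos (by omega)]; simp) (by simp [bn]) (fun i hi => (hbd i hi).1)
  have hlip := hPl (n / 2) (fun i hi => by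
    have := (hbd i hi).2
    push_cast
    have e : (n : ℝ) / 2 * ((i + 1) / n - i / n) = 1 / 2 := by field_simp; ring
    rw [e]; exact this)
  have hP0 : P 0 = 0 := by
    have := hPv 0 (by omega) 0 le_rfl zero_le_one
    simp only [bn] at this
    rw [if_pos (by omega)] at this
    simpa using this
  have hgm : Monotone (fun x : ℝ => P (x / n)) := fun x y h => P.monotone (by gcongr)
  have hgl : ∀ x y : ℝ, x ≤ y → P (y / n) - P (x / n) ≤ (y - x) / 2 := by
    intro x y h
    refine (hlip _ _ (by gcongr)).trans (le_of_eq ?_)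
    field_simp
  have hPs : ∀ x, P.symm (x + 1) = P.symm x + 1 := fun x => by
    apply P.injective; simp [hP1]
  obtain ⟨H, hHm, hH1, hHf⟩ := exists_semi n (fun x => P (x / n)) (fun x => n * x) hgm hgl
    (fun x => by rw [add_div, div_self hn0.ne', hP1]) (fun x y h => by dsimp; gcongr)
    (fun x => by ring)
  have hdm : Monotone (fun x : ℝ => x / n) := fun x y h => by dsimp; gcongr
  have hdl : ∀ x y : ℝ, x ≤ y → y / n - x / n ≤ (y - x) / 2 := by
    intro x y h
    rw [← sub_div]
    have : 0 ≤ y - x := by linarith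
    gcongr
  obtain ⟨H', hHm', hH1', hHf'⟩ := exists_semi n (fun x => x / n) (fun x => n * P.symm x) hdm hdl
    (fun x => by rw [add_div, div_self hn0.ne']) (fun x y h => by
      have := P.symm.monotone h
      dsimp; gcongr)
    (fun x => by rw [hPs]; ring)
  have c1 : ∀ x, H (H' x) = x := by
    apply semi_unique (p := fun x => P (x / n)) (q := fun x => n * P.symm x) (abs_lip hgm hgl)
    · intro x; rw [mul_div_cancel_left₀ _ hn0.ne']; simp
    · exact hHm.comp hHm'
    · intro x; rw [hH1', hH1]
    · intro x
      rw [hHf (H' x), hHf' x]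
      rw [mul_div_cancel₀ _ hn0.ne']
  have c2 : ∀ x, H' (H x) = x := by
    apply semi_unique (p := fun x => x / n) (q := fun x => n * x) (abs_lip hdm hdl)
    · intro x; rw [mul_div_cancel_left₀ _ hn0.ne']
    · exact hHm'.comp hHm
    · intro x; rw [hH1, hH1']
    · intro x
      rw [hHf' (H x), hHf x]
      rw [P.symm_apply_apply, mul_div_cancel₀ _ hn0.ne']
  have hsm : StrictMono H := hHm.strictMono_of_injective (Function.LeftInverse.injective c2)
  have hH0 : H 0 = 0 := by
    have h1 := abs_lip hgm hgl (H 0) 0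
    have h2 := hHf 0
    simp only [mul_zero] at h2
    simp only [zero_div] at h1
    rw [← h2, hP0] at h1
    have : |H 0 - 0| ≤ 0 := by linarith
    have := abs_nonpos_iff.1 this
    linarith
  refine ⟨hsm.orderIsoOfSurjective H (fun y => ⟨H' y, c1 y⟩), hH1, hH0, ?_⟩
  intro d hd s h0 h1
  change H ((d + s) / n) = bn n d + H s * (bn n (d + 1) - bn n d)
  rw [hHf]
  rw [mul_div_cancel₀ _ hn0.ne', add_comm (d : ℝ) s, deg1_nat hH1]
  have k0 : 0 ≤ H s := hH0 ▸ hHm h0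
  have k1 : H s ≤ 1 := by
    have := hHm h1
    have e := hH1 0
    rw [zero_add, hH0, zero_add] at e
    linarith
  rw [← hPv d hd (H s) k0 k1]
  congr 1
  push_cast
  field_simp
  ring

def code (n : ℕ) (d : Fin n) : List (Fin 2) :=
  if (d : ℕ) + 1 < n then List.replicate d 1 ++ [0] else List.replicate d 1

def sig (n : ℕ) (w : List (Fin n)) : List (Fin 2) := w.flatMap (code n)

lemma bt_replicate (d : ℕ) (s : ℝ) :
    bt 2 (List.replicate d 1) s = 1 - (1 / 2) ^ d + (1 / 2) ^ d * s := by
  induction d with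
  | zero => simp [bt]
  | succ d ih =>
    rw [List.replicate_succ, bt, ih, pow_succ]
    push_cast
    simp
    ring

lemma bt_code {n : ℕ} (hn : 2 ≤ n) (d : Fin n) (s : ℝ) :
    bt 2 (code n d) s = bn n d + s * (bn n (d + 1) - bn n d) := by
  have hd := d.2
  unfold code bn
  rw [if_pos hd]
  by_cases h : (d : ℕ) + 1 < n
  · rw [if_pos h, if_pos h, bt_append, bt_replicate]
    simp [bt, pow_succ]
    ring
  · rw [if_neg h, if_neg h, bt_replicate]
    ring

lemma sig_back {n : ℕ} (hn : 2 ≤ n) (v : List (Fin 2)) (u : List (Fin n))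
    (h : sig n u = v ++ List.replicate (n - 1) 1) : ∃ u', v = sig n u' := by
  rcases List.eq_nil_or_concat u with rfl | ⟨u', d, rfl⟩
  · have := congrArg List.length h
    simp [sig] at this
    omega
  · refine ⟨u', ?_⟩
    have hd := d.2
    simp only [sig, List.concat_eq_append, List.flatMap_append, List.flatMap_cons, List.flatMap_nil,
      List.append_nil] at h
    by_cases hdn : (d : ℕ) + 1 < n
    · exfalso
      have hc : code n d = List.replicate d 1 ++ [0] := by unfold code; rw [if_pos hdn]
      obtain ⟨k, hk⟩ : ∃ k, n - 1 = k + 1 := ⟨n - 2, by omega⟩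
      rw [hc, hk, List.replicate_succ', ← List.append_assoc, ← List.append_assoc] at h
      have := (List.append_inj' h rfl).2
      simp at this
    · have hc : code n d = List.replicate (n - 1) 1 := by
        unfold code; rw [if_neg hdn]; congr 1; omega
      rw [hc] at h
      exact (List.append_cancel_right h).symm

lemma sig_back' {n : ℕ} (hn : 2 ≤ n) (k : ℕ) (v : List (Fin 2)) (u : List (Fin n))
    (h : sig n u = v ++ List.replicate (k * (n - 1)) 1) : ∃ u', v = sig n u' := by
  induction k generalizing u with
  | zero => exact ⟨u, by simpa using h.symm⟩
  | succ k ih =>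
    rw [Nat.succ_mul, List.replicate_add, ← List.append_assoc] at h
    obtain ⟨u', hu'⟩ := sig_back hn _ u h
    exact ih u' hu'.symm

lemma sig_replicate {n : ℕ} (hn : 2 ≤ n) (k : ℕ) :
    sig n (List.replicate k ⟨n - 1, by omega⟩) = List.replicate (k * (n - 1)) 1 := by
  induction k with
  | zero => simp [sig]
  | succ k ih =>
    rw [List.replicate_succ, sig, List.flatMap_cons, ← sig, ih, Nat.succ_mul, Nat.add_comm,
      List.replicate_add]
    congr 1
    unfold code
    rw [if_neg]
    simp; omega

section HH
variable {n : ℕ} (hn : 2 ≤ n) (H : ℝ ≃o ℝ) (hH1 : ∀ x, H (x + 1) = H x + 1) (hH0 : H 0 = 0)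
  (hHd : ∀ d, d < n → ∀ s, 0 ≤ s → s ≤ 1 →
      H ((d + s) / n) = bn n d + H s * (bn n (d + 1) - bn n d))
  (h : Circle ≃ₜ Circle) (hh : IsLift h H)

include hn hHd in
lemma H_bt (w : List (Fin n)) {s : ℝ} (h0 : 0 ≤ s) (h1 : s ≤ 1) :
    H (bt n w s) = bt 2 (sig n w) (H s) := by
  induction w with
  | nil => rfl
  | cons d w ih =>
    have b := bt_mem w h0 h1
    have e : sig n (d :: w) = code n d ++ sig n w := by simp [sig]
    rw [bt, hHd d d.2 _ b.1 b.2, ih, e, bt_append, bt_code hn]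

include hH1 hH0 in
lemma H_unit {s : ℝ} (h0 : 0 ≤ s) (h1 : s ≤ 1) : 0 ≤ H s ∧ H s ≤ 1 := by
  have e := hH1 0
  rw [zero_add, hH0, zero_add] at e
  have a := H.monotone h0
  have b := H.monotone h1
  constructor <;> linarith

include hH1 hH0 in
lemma H_symm_unit {s : ℝ} (h0 : 0 ≤ s) (h1 : s ≤ 1) : 0 ≤ H.symm s ∧ H.symm s ≤ 1 := by
  have e := hH1 0
  rw [zero_add, hH0, zero_add] at e
  constructor
  · rw [← H.le_iff_le, hH0]; simpa
  · rw [← H.le_iff_le, e]; simpa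

include hn hH1 hH0 hHd hh in
lemma maps_conj (f : Circle ≃ₜ Circle) (w w' : List (Fin n)) :
    MapsW n f w w' ↔ MapsW 2 (h * f * h⁻¹) (sig n w) (sig n w') := by
  have key : ∀ s, 0 ≤ s → s ≤ 1 → ∀ v : List (Fin n),
      h ((bt n v s : ℝ) : Circle) = ((bt 2 (sig n v) (H s) : ℝ) : Circle) := by
    intro s h0 h1 v
    rw [hh, H_bt hn H hHd v h0 h1]
  constructor
  · intro hm s h0 h1
    have b := H_symm_unit H hH1 hH0 h0 h1
    have e : H (H.symm s) = s := H.apply_symm_apply s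
    rw [← e, ← key _ b.1 b.2, ← key _ b.1 b.2, homeo_mul_apply, homeo_mul_apply, homeo_inv_apply,
      hm _ b.1 b.2]
  · intro hm s h0 h1
    have b := H_unit H hH1 hH0 h0 h1
    have := hm _ b.1 b.2
    rw [← key _ h0 h1, ← key _ h0 h1, homeo_mul_apply, homeo_mul_apply, homeo_inv_apply] at this
    exact h.injective this

include hn hHd in
lemma sig_inj : Function.Injective (sig n) := by
  intro w v e
  apply bt_inj hn
  intro s h0 h1
  have e1 := H_bt hn H hHd w h0 h1
  rw [e, ← H_bt hn H hHd v h0 h1] at e1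
  rw [H.injective e1]

include hn hH1 hH0 hHd hh in
lemma conj_InT {f : Circle ≃ₜ Circle} (hf : InT n f) : InT 2 (h * f * h⁻¹) := by
  have hp := Tn_props hn (Subgroup.subset_closure hf : f ∈ Tn n)
  obtain ⟨⟨K, hK⟩, hQ⟩ := hp
  have hQh : QL h := ⟨H, hH1, hh⟩
  have hn0 : (0 : ℝ) < n := by positivity
  have hH1' : H 1 = 1 := by
    have e := hH1 0
    rwa [zero_add, hH0, zero_add] at e
  refine InT_of le_rfl (QL.mul hQh.inv (QL.mul hQ hQh)) (n ^ K)
    (fun i => H ((i : ℝ) / (n : ℝ) ^ K)) (by positivity) (by simp [hH0]) ?_ ?_ ?_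
  · push_cast
    rw [div_self (by positivity), hH1']
  · intro i hi
    apply H.strictMono
    push_cast
    gcongr
    linarith
  · intro i hi
    obtain ⟨w, hw, e⟩ := bt_of_nat hn K i hi
    obtain ⟨w', hw'⟩ := hK w hw.ge
    refine ⟨sig n w, sig n w', ?_, ?_, (maps_conj hn H hH1 hH0 hHd h hh f w w').1 hw'⟩
    · have := H_bt hn H hHd w le_rfl zero_le_one
      rw [hH0, e, add_zero] at this
      exact this
    · have := H_bt hn H hHd w zero_le_one le_rfl
      rw [hH1', e] at this
      push_cast
      exact this

include hn hH1 hH0 hHd hh in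
lemma cpx_conj {f : Circle ≃ₜ Circle} (hf : EG n f) (hf2 : EG 2 (h * f * h⁻¹)) :
    cpx n f ≤ cpx 2 (h * f * h⁻¹) := by
  have hsub : sig n '' Bad n f ⊆ Bad 2 (h * f * h⁻¹) := by
    rintro _ ⟨w, hw, rfl⟩ ⟨v, hv⟩
    apply hw
    obtain ⟨K, hK⟩ := hf
    obtain ⟨w'', hw''⟩ := hK (w ++ List.replicate K ⟨n - 1, by omega⟩) (by simp)
    have h1 := (maps_conj hn H hH1 hH0 hHd h hh f _ _).1 hw''
    have h2 := hv.append (sig n (List.replicate K ⟨n - 1, by omega⟩))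
    have e : sig n (w ++ List.replicate K ⟨n - 1, by omega⟩) =
      sig n w ++ sig n (List.replicate K ⟨n - 1, by omega⟩) := by simp [sig]
    rw [e] at h1
    have e2 := h1.right_unique le_rfl h2
    rw [sig_replicate hn] at e2
    obtain ⟨u', rfl⟩ := sig_back' hn K v w'' e2
    exact ⟨u', (maps_conj hn H hH1 hH0 hHd h hh f _ _).2 hv⟩
  unfold cpx
  rw [← Set.InjOn.ncard_image (sig_inj hn H hHd).injOn]
  exact Set.ncard_le_ncard hsub (Bad_finite hf2)

end HH

def ex (n i : ℕ) (t : ℕ → ℝ) (j : ℕ) : ℝ :=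
  if j ≤ i then t j else if j ≤ i + n then t i + ((j : ℝ) - i) / n * (t (i + 1) - t i)
    else t (j - (n - 1))

lemma ex_le {n i j : ℕ} {t : ℕ → ℝ} (h : j ≤ i) : ex n i t j = t j := by
  unfold ex; rw [if_pos h]

lemma ex_mid {n i j : ℕ} {t : ℕ → ℝ} (h : i ≤ j) (h' : j ≤ i + n) :
    ex n i t j = t i + ((j : ℝ) - i) / n * (t (i + 1) - t i) := by
  unfold ex
  rcases h.eq_or_lt with rfl | h
  · simp
  · rw [if_neg (by omega), if_pos h']

lemma ex_ge {n i j : ℕ} (hn : 2 ≤ n) {t : ℕ → ℝ} (h : i + n ≤ j) :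
    ex n i t j = t (j - (n - 1)) := by
  have hn0 : (n : ℝ) ≠ 0 := by positivity
  rcases h.eq_or_lt with rfl | h
  · rw [ex_mid (by omega) le_rfl]
    have : i + n - (n - 1) = i + 1 := by omega
    rw [this]; push_cast; field_simp; ring
  · unfold ex
    rw [if_neg (by omega), if_neg (by omega)]

lemma ex_ge' {n i j : ℕ} (hn : 2 ≤ n) {t : ℕ → ℝ} (h : i < j) :
    ex n i t (j + (n - 1)) = t j := by
  rw [ex_ge hn (by omega), Nat.add_sub_cancel]

lemma ex_comm {n i j : ℕ} (hn : 2 ≤ n) (hij : i < j) (t : ℕ → ℝ) :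
    ex n (j + (n - 1)) (ex n i t) = ex n i (ex n j t) := by
  funext k
  rcases le_or_gt k i with h1 | h1
  · rw [ex_le (by omega), ex_le h1, ex_le h1, ex_le (by omega)]
  rcases le_or_gt k (i + n) with h2 | h2
  · rw [ex_le (by omega), ex_mid h1.le h2, ex_mid h1.le h2, ex_le (by omega), ex_le (by omega)]
  rw [ex_ge hn h2.le]
  rcases le_or_gt k (j + (n - 1)) with h3 | h3
  · rw [ex_le h3, ex_ge hn h2.le, ex_le (by omega)]
  rcases le_or_gt k (j + (n - 1) + n) with h4 | h4
  · rw [ex_mid h3.le h4, ex_ge' hn hij, show j + (n - 1) + 1 = (j + 1) + (n - 1) by omega,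
      ex_ge' hn (by omega), ex_mid (by omega) (by omega)]
    congr 3
    rw [Nat.cast_sub (by omega)]; push_cast; ring
  · rw [ex_ge hn h4.le, ex_ge hn (by omega), ex_ge hn (by omega)]

def Maps (N : ℕ) (f : Circle ≃ₜ Circle) (t u : ℕ → ℝ) : Prop :=
  ∀ i, i < N → ∀ s : ℝ, 0 ≤ s → s ≤ 1 →
    f ((t i + s * (t (i + 1) - t i) : ℝ) : Circle) = ((u i + s * (u (i + 1) - u i) : ℝ) : Circle)

structure Part (n N : ℕ) (t : ℕ → ℝ) : Prop where
  last : t N = t 0 + 1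
  lev : ∀ i, i < N → ∃ (a : ℤ) (k : ℕ), t i = a / (n : ℝ) ^ k ∧ t (i + 1) = (a + 1) / (n : ℝ) ^ k

lemma Part.inc {n N : ℕ} (hn : 2 ≤ n) {t : ℕ → ℝ} (h : Part n N t) :
    ∀ i, i < N → t i < t (i + 1) := by
  intro i hi
  obtain ⟨a, k, h1, h2⟩ := h.lev i hi
  have hn0 : (0 : ℝ) < n := by positivity
  rw [h1, h2]
  gcongr
  linarith

lemma Maps.comp {N : ℕ} {f g : Circle ≃ₜ Circle} {t u v : ℕ → ℝ} (hf : Maps N f t u)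
    (hg : Maps N g u v) : Maps N (g * f) t v := by
  intro i hi s h0 h1
  rw [homeo_mul_apply, hf i hi s h0 h1, hg i hi s h0 h1]

lemma Maps.inv {N : ℕ} {f : Circle ≃ₜ Circle} {t u : ℕ → ℝ} (hf : Maps N f t u) :
    Maps N f⁻¹ u t := by
  intro i hi s h0 h1
  rw [← hf i hi s h0 h1, homeo_inv_apply]

lemma Maps.one (N : ℕ) (t : ℕ → ℝ) : Maps N 1 t t := fun _ _ _ _ _ => rfl

lemma Maps.ex {n N : ℕ} (hn : 2 ≤ n) {f : Circle ≃ₜ Circle} {t u : ℕ → ℝ} (hf : Maps N f t u)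
    {i : ℕ} (hi : i < N) : Maps (N + (n - 1)) f (ex n i t) (ex n i u) := by
  intro j hj s h0 h1
  have hn0 : (0 : ℝ) < n := by positivity
  rcases lt_or_ge j i with h | h
  · rw [ex_le h.le, ex_le h, ex_le h.le, ex_le h]
    exact hf j (by omega) s h0 h1
  rcases lt_or_ge j (i + n) with h' | h'
  · rw [ex_mid h h'.le, ex_mid h h'.le, ex_mid (by omega) h', ex_mid (by omega) h']
    have e1 : (j : ℝ) + 1 ≤ i + n := by exact_mod_cast h'
    have e2 : (i : ℝ) ≤ j := by exact_mod_cast h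
    have := hf i hi (((j : ℝ) - i + s) / n) (by apply div_nonneg <;> linarith)
      (by rw [div_le_one hn0]; linarith)
    have e : ∀ A B : ℝ, A + ((j : ℝ) - i) / n * (B - A) + s * (A + (((j + 1 : ℕ) : ℝ) - i) / n * (B - A)
        - (A + ((j : ℝ) - i) / n * (B - A))) = A + ((j : ℝ) - i + s) / n * (B - A) := by
      intro A B; push_cast; field_simp; ring
    rw [e, e]
    exact this
  · rw [ex_ge hn h', ex_ge hn h', ex_ge hn (by omega), ex_ge hn (by omega),
      show j + 1 - (n - 1) = (j - (n - 1)) + 1 by omega]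
    exact hf _ (by omega) s h0 h1

lemma Part.ex {n N : ℕ} (hn : 2 ≤ n) {t : ℕ → ℝ} (h : Part n N t) {i : ℕ} (hi : i < N) :
    Part n (N + (n - 1)) (ex n i t) := by
  have hn0 : (0 : ℝ) < n := by positivity
  refine ⟨?_, ?_⟩
  · rw [ex_ge' hn hi, ex_le (by omega), h.last]
  intro j hj
  rcases lt_or_ge j i with h1 | h1
  · rw [ex_le h1.le, ex_le h1]
    exact h.lev j (by omega)
  rcases lt_or_ge j (i + n) with h' | h'
  · rw [ex_mid h1 h'.le, ex_mid (by omega) h']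
    obtain ⟨a, k, ha, hb⟩ := h.lev i hi
    refine ⟨a * n + (j - i), k + 1, ?_, ?_⟩
    · rw [ha, hb]; push_cast; rw [pow_succ]; field_simp; ring
    · rw [ha, hb]; push_cast; rw [pow_succ]; field_simp; ring
  · rw [ex_ge hn h', ex_ge hn (by omega), show j + 1 - (n - 1) = (j - (n - 1)) + 1 by omega]
    exact h.lev _ (by omega)

lemma Part.find {n N : ℕ} (hn : 2 ≤ n) {t : ℕ → ℝ} (h : Part n N t) {x : ℝ} (h0 : t 0 ≤ x)
    (h1 : x < t 0 + 1) : ∃ i, i < N ∧ t i ≤ x ∧ x < t (i + 1) := by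
  have : ∀ M, x < t M → M ≤ N → ∃ i, i < N ∧ t i ≤ x ∧ x < t (i + 1) := by
    intro M
    induction M with
    | zero => intro h2; linarith
    | succ M ih =>
      intro h2 hM
      rcases le_or_gt (t M) x with h3 | h3
      · exact ⟨M, by omega, h3, h2⟩
      · exact ih h3 (by omega)
  exact this N (by rw [h.last]; exact h1) le_rfl

lemma Maps.unique {n N : ℕ} (hn : 2 ≤ n) {f g : Circle ≃ₜ Circle} {t u : ℕ → ℝ} (h : Part n N t)
    (hf : Maps N f t u) (hg : Maps N g t u) : f = g := by
  refine Homeomorph.ext fun p => ?_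
  obtain ⟨y, hy0, hy1, rfl⟩ := exists_fract_rep (p - ((t 0 : ℝ) : Circle)) |>.imp fun y hy => by
    exact (⟨hy.1, hy.2.1, by rw [AddCircle.coe_add, hy.2.2]; abel⟩ :
      0 ≤ y ∧ y < 1 ∧ p = ((t 0 + y : ℝ) : Circle))
  obtain ⟨i, hi, h1, h2⟩ := h.find hn (x := t 0 + y) (by linarith) (by linarith)
  have hd : 0 < t (i + 1) - t i := sub_pos.2 (h.inc hn i hi)
  have e : t 0 + y = t i + ((t 0 + y - t i) / (t (i + 1) - t i)) * (t (i + 1) - t i) := by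
    field_simp; ring
  have s0 : 0 ≤ (t 0 + y - t i) / (t (i + 1) - t i) := div_nonneg (by linarith) hd.le
  have s1 : (t 0 + y - t i) / (t (i + 1) - t i) ≤ 1 := by rw [div_le_one hd]; linarith
  rw [e, hf i hi _ s0 s1, hg i hi _ s0 s1]

lemma Part.word {n N : ℕ} (hn : 2 ≤ n) {t : ℕ → ℝ} (h : Part n N t) (h0 : t 0 = 0) {i : ℕ}
    (hi : i < N) : ∃ w : List (Fin n), t i = bt n w 0 ∧ t (i + 1) = bt n w 1 ∧
      ∀ s, bt n w s = t i + s * (t (i + 1) - t i) := by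
  obtain ⟨a, k, h1, h2⟩ := h.lev i hi
  have hn0 : (0 : ℝ) < n := by positivity
  have hp : (0 : ℝ) < (n : ℝ) ^ k := by positivity
  have m0 : t 0 ≤ t i := mono_of_inc (h.inc hn) (Nat.zero_le _) hi.le
  have m1 : t (i + 1) ≤ t N := mono_of_inc (h.inc hn) hi le_rfl
  rw [h.last, h0, h2, zero_add, div_le_one hp] at m1
  rw [h0, h1] at m0
  have a0 : (0 : ℝ) ≤ a := by
    by_contra hc
    have := div_neg_of_neg_of_pos (not_le.1 hc) hp
    linarith
  have a0' : (0 : ℤ) ≤ a := by exact_mod_cast a0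
  lift a to ℕ using a0'
  obtain ⟨w, hw, hw'⟩ := bt_of_nat hn k a (by
    have : (a : ℝ) + 1 ≤ (n : ℝ) ^ k := by simpa using m1
    exact_mod_cast this)
  refine ⟨w, ?_, ?_, ?_⟩
  · rw [hw', h1]; simp
  · rw [hw', h2]; simp
  · intro s
    rw [hw', h1, h2]; simp only [Int.cast_natCast]; ring

lemma exists_map {n N : ℕ} (hn : 2 ≤ n) {t u : ℕ → ℝ} (ht : Part n N t) (hu : Part n N u)
    (ht0 : t 0 = 0) (hu0 : u 0 = 0) : ∃ f ∈ Tn n, Maps N f t u := by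
  have htN : t N = 1 := by rw [ht.last, ht0, zero_add]
  have huN : u N = 1 := by rw [hu.last, hu0, zero_add]
  have hN : 0 < N := by
    rcases Nat.eq_zero_or_pos N with rfl | h
    · linarith
    · exact h
  obtain ⟨P, hP, hv, -⟩ := exists_PL N t u ht0 htN (ht.inc hn) hu0 huN (hu.inc hn)
  obtain ⟨f, hf⟩ := exists_homeo P hP
  have hm : Maps N f t u := by
    intro i hi s h0 h1
    rw [hf]
    rw [hv i hi s h0 h1]
  refine ⟨f, Subgroup.subset_closure ?_, hm⟩
  refine InT_of hn ⟨P, hP, hf⟩ N t hN ht0 htN (ht.inc hn) fun i hi => ?_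
  obtain ⟨w, hw0, hw1, hw⟩ := ht.word hn ht0 hi
  obtain ⟨w', -, -, hw'⟩ := hu.word hn hu0 hi
  refine ⟨w, w', hw0, hw1, fun s h0 h1 => ?_⟩
  rw [hw, hw']
  exact hm i hi s h0 h1

def V (n : ℕ) : ℕ → ℕ → ℝ
  | 0 => fun j => j
  | m + 1 => ex n ((n - 1) * m) (V n m)

def NN (n m : ℕ) : ℕ := 1 + (n - 1) * m

lemma NN_succ (n m : ℕ) : NN n (m + 1) = NN n m + (n - 1) := by unfold NN; ring

lemma V_zero (n m : ℕ) : V n m 0 = 0 := by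
  induction m with
  | zero => simp [V]
  | succ m ih => rw [V, ex_le (by omega), ih]

lemma V_part {n : ℕ} (hn : 2 ≤ n) (m : ℕ) : Part n (NN n m) (V n m) := by
  induction m with
  | zero =>
    refine ⟨by simp [V, NN], fun i hi => ⟨0, 0, ?_⟩⟩
    simp [NN] at hi
    subst hi
    simp [V]
  | succ m ih =>
    rw [NN_succ]
    exact ih.ex hn (by unfold NN; omega)

lemma V_r {n : ℕ} (hn : 2 ≤ n) {k r : ℕ} (hk : 1 ≤ k) (hr : r ≤ n - 1) : V n k r = r / n := by
  induction k, hk using Nat.le_induction with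
  | base =>
    rw [V, ex_mid (by simp) (by simp; omega)]
    simp [V]
  | succ k hk ih =>
    rw [V, ex_le (hr.trans (Nat.le_mul_of_pos_right _ hk)), ih]

lemma Part.level_pos {n N : ℕ} (hn : 2 ≤ n) {t : ℕ → ℝ} (h : Part n N t) (hN : 1 < N) {i : ℕ}
    (hi : i < N) : t (i + 1) < t i + 1 := by
  have m0 : t 0 ≤ t i := mono_of_inc (h.inc hn) (Nat.zero_le _) hi.le
  have m1 : t (i + 1) ≤ t N := mono_of_inc (h.inc hn) hi le_rfl
  have hl := h.last
  rcases Nat.eq_zero_or_pos i with rfl | h'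
  · have := smono_of_inc (h.inc hn) (i := 0 + 1) (by omega : 0 + 1 < N) le_rfl
    linarith
  · have := smono_of_inc (h.inc hn) h' hi.le
    linarith

lemma exists_x {n : ℕ} (hn : 2 ≤ n) (i : ℕ) : ∃ g ∈ Tn n, ∀ m, i < (n - 1) * m →
    Maps (NN n (m + 1)) g (ex n i (V n m)) (V n (m + 1)) := by
  have key : i < (n - 1) * (i / (n - 1) + 1) := by
    have := Nat.lt_mul_div_succ i (show 0 < n - 1 by omega)
    exact this
  have p : ∀ m, i < (n - 1) * m → Part n (NN n (m + 1)) (ex n i (V n m)) := by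
    intro m hm
    rw [NN_succ]
    exact (V_part hn m).ex hn (by unfold NN; omega)
  obtain ⟨g, hg, hm⟩ := exists_map hn (p _ key) (V_part hn (i / (n - 1) + 1 + 1))
    (by rw [ex_le (by omega), V_zero]) (V_zero _ _)
  refine ⟨g, hg, fun m him => ?_⟩
  have hle : i / (n - 1) + 1 ≤ m := by
    rw [Nat.succ_le_iff, Nat.div_lt_iff_lt_mul (by omega), mul_comm]; exact him
  clear him
  induction m, hle using Nat.le_induction with
  | base => exact hm
  | succ m hm' ih =>
    have him : i < (n - 1) * m := key.trans_le (Nat.mul_le_mul_left _ hm')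
    have := ih.ex hn (i := (n - 1) * (m + 1)) (by unfold NN; omega)
    rw [← NN_succ] at this
    have e : ex n ((n - 1) * (m + 1)) (ex n i (V n m)) = ex n i (V n (m + 1)) := by
      rw [Nat.mul_succ, ex_comm hn him, V]
    rw [e] at this
    exact this

lemma rel_x {n : ℕ} (hn : 2 ≤ n) {x : ℕ → Circle ≃ₜ Circle}
    (hx : ∀ i m, i < (n - 1) * m → Maps (NN n (m + 1)) (x i) (ex n i (V n m)) (V n (m + 1)))
    {i : ℕ} (hi : 1 ≤ i) : x (i + (n - 1)) = x 0 * x i * (x 0)⁻¹ := by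
  have hm : i < (n - 1) * (i + 1) := by
    have : 1 * (i + 1) ≤ (n - 1) * (i + 1) := Nat.mul_le_mul_right _ (by omega)
    omega
  have hV := V_part hn (i + 1)
  have hN : i < NN n (i + 1) := by unfold NN; omega
  have a1 := (hx 0 (i + 1) (by omega)).ex hn (i := i + (n - 1)) (by rw [NN_succ]; omega)
  have a2 := hx (i + (n - 1)) (i + 1 + 1) (by rw [Nat.mul_succ]; omega)
  rw [← NN_succ, ex_comm hn (by omega)] at a1
  have b1 := (hx i (i + 1) hm).ex hn (i := 0) (by unfold NN; omega)
  have b2 := hx 0 (i + 1 + 1) (by rw [Nat.mul_succ]; omega)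
  rw [← NN_succ] at b1
  have p : Part n (NN n (i + 1 + 1 + 1)) (ex n 0 (ex n i (V n (i + 1)))) := by
    rw [NN_succ, NN_succ]
    exact (hV.ex hn hN).ex hn (by omega)
  have := Maps.unique hn p (a1.comp a2) (b1.comp b2)
  rw [← this]; group

lemma level_eq {n : ℕ} (hn : 2 ≤ n) {a b : ℤ} {k k' : ℕ} (h : (a : ℝ) / (n : ℝ) ^ k = b / (n : ℝ) ^ k')
    (hk : k' ≤ k) (ha : ¬ (n : ℤ) ∣ a) : k' = k ∧ a = b := by
  have hn0 : (0 : ℝ) < n := by positivity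
  obtain ⟨c, rfl⟩ := Nat.exists_eq_add_of_le hk
  have e : a = b * (n : ℤ) ^ c := by
    have : (a : ℝ) = b * (n : ℝ) ^ c := by
      rw [pow_add] at h
      field_simp at h
      linarith
    exact_mod_cast this
  rcases Nat.eq_zero_or_pos c with rfl | hc
  · exact ⟨rfl, by simpa using e⟩
  · exfalso
    apply ha
    rw [e]
    exact Dvd.dvd.mul_left (dvd_pow_self _ hc.ne') _

lemma int_dvd {n : ℕ} (hn : 2 ≤ n) {a z : ℤ} {k : ℕ} (hk : 1 ≤ k) (h : (a : ℝ) / (n : ℝ) ^ k = z) :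
    (n : ℤ) ∣ a := by
  have hn0 : (0 : ℝ) < n := by positivity
  have e : a = z * (n : ℤ) ^ k := by
    have : (a : ℝ) = z * (n : ℝ) ^ k := by
      field_simp at h
      linarith
    exact_mod_cast this
  rw [e]
  exact Dvd.dvd.mul_left (dvd_pow_self _ (by omega)) _

def Expo (n N : ℕ) (u : ℕ → ℝ) (i : ℕ) : Prop :=
  ∃ N' u', Part n N' u' ∧ i < N' ∧ N = N' + (n - 1) ∧ u = ex n i u'

lemma exists_expo {n N : ℕ} (hn : 2 ≤ n) {u : ℕ → ℝ} (hu : Part n N u) (hu0 : u 0 = 0)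
    (hN : 1 < N) : ∃ i, Expo n N u i := by
  have hn0 : (0 : ℝ) < n := by positivity
  choose! a k hl hr using hu.lev
  obtain ⟨i, hi, hmax⟩ := Finset.exists_max_image (Finset.range N) k ⟨0, by simp; omega⟩
  simp only [Finset.mem_range] at hi hmax
  have hk : 1 ≤ k i := by
    by_contra hc
    have h0 : k i = 0 := by omega
    have := hu.level_pos hn hN hi
    rw [hl i hi, hr i hi, h0] at this
    simp at this
  have hlast : u N = ((1 : ℤ) : ℝ) := by rw [hu.last, hu0]; simp
  have hfirst : u 0 = ((0 : ℤ) : ℝ) := by rw [hu0]; simp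
  set q := a i / (n : ℤ) with hq
  obtain ⟨d, hd⟩ : ∃ d : ℕ, (d : ℤ) = a i % n :=
    ⟨(a i % n).toNat, Int.toNat_of_nonneg (Int.emod_nonneg _ (by omega))⟩
  have hdn : d < n := by
    have := Int.emod_lt_of_pos (a i) (show (0 : ℤ) < n by omega)
    omega
  have hai : a i = n * q + d := by
    rw [hd, hq]; exact (Int.mul_ediv_add_emod _ _).symm
  have ndvd : ∀ c : ℤ, 0 < c → c < n → ¬ (n : ℤ) ∣ n * q + c := by
    intro c h0 h1 h
    have := (Int.dvd_add_right (dvd_mul_right (n : ℤ) q)).1 h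
    have := Int.le_of_dvd h0 this
    omega
  have right : ∀ c : ℕ, c + d + 1 ≤ n →
      i + (c + 1) ≤ N ∧ u (i + (c + 1)) = ((n * q + (d + c + 1) : ℤ) : ℝ) / (n : ℝ) ^ k i := by
    intro c
    induction c with
    | zero =>
      intro _
      refine ⟨hi, ?_⟩
      rw [zero_add, hr i hi, hai]; push_cast; ring
    | succ c ih =>
      intro hc
      obtain ⟨h1, h2⟩ := ih (by omega)
      have nd := ndvd (d + c + 1) (by omega) (by omega)
      have h3 : i + (c + 1) < N := by
        rcases h1.lt_or_eq with h | h
        · exact h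
        · exfalso
          rw [h, hlast] at h2
          exact nd (int_dvd hn hk h2.symm)
      refine ⟨h3, ?_⟩
      have e := level_eq hn (h2.symm.trans (hl _ h3)) (hmax _ h3) nd
      have := hr _ h3
      rw [e.1, ← e.2] at this
      rw [show i + (c + 1 + 1) = i + (c + 1) + 1 by omega, this]
      push_cast; ring
  have left : ∀ c : ℕ, c ≤ d →
      c ≤ i ∧ u (i - c) = ((n * q + (d - c) : ℤ) : ℝ) / (n : ℝ) ^ k i := by
    intro c
    induction c with
    | zero =>
      intro _
      refine ⟨by omega, ?_⟩
      rw [Nat.sub_zero, hl i hi, hai]; push_cast; ring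
    | succ c ih =>
      intro hc
      obtain ⟨h1, h2⟩ := ih (by omega)
      have nd := ndvd (d - c) (by omega) (by omega)
      have h3 : c + 1 ≤ i := by
        rcases h1.lt_or_eq with h | h
        · exact h
        · exfalso
          rw [show i - c = 0 by omega, hfirst] at h2
          exact nd (int_dvd hn hk h2.symm)
      refine ⟨h3, ?_⟩
      have h4 : i - (c + 1) < N := by omega
      have h5 := hr _ h4
      rw [show i - (c + 1) + 1 = i - c by omega] at h5
      have e := level_eq hn (b := a (i - (c + 1)) + 1) (h2.symm.trans (by rw [h5]; push_cast; ring))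
        (hmax _ h4) nd
      have := hl _ h4
      rw [e.1, ← eq_sub_iff_add_eq.2 e.2.symm |>.symm] at this
      rw [this]
      push_cast; ring
  have hdi := (left d le_rfl).1
  have hin := (right (n - 1 - d) (by omega)).1
  have vals : ∀ c : ℕ, c ≤ n → u (i - d + c) = ((n * q + c : ℤ) : ℝ) / (n : ℝ) ^ k i := by
    intro c hc
    rcases le_or_gt c d with h | h
    · have := (left (d - c) (by omega)).2
      rw [show i - d + c = i - (d - c) by omega, this]
      push_cast [Nat.cast_sub h]; ring
    · have := (right (c - d - 1) (by omega)).2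
      rw [show i - d + c = i + (c - d - 1 + 1) by omega, this]
      congr 2
      omega
  set i0 := i - d with hi0
  obtain ⟨k', hk'⟩ : ∃ k', k i = k' + 1 := ⟨k i - 1, by omega⟩
  let u' : ℕ → ℝ := fun j => if j ≤ i0 then u j else u (j + (n - 1))
  have ul : ∀ j, j ≤ i0 → u' j = u j := fun j h => if_pos h
  have ug : ∀ j, i0 < j → u' j = u (j + (n - 1)) := fun j h => if_neg (by omega)
  have v0 : u i0 = (q : ℝ) / (n : ℝ) ^ k' := by
    have := vals 0 (by omega)
    rw [add_zero, hk', pow_succ] at this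
    rw [this]; push_cast; field_simp; ring
  have vn : u (i0 + n) = ((q : ℝ) + 1) / (n : ℝ) ^ k' := by
    have := vals n le_rfl
    rw [hk', pow_succ] at this
    rw [this]; push_cast; field_simp
  refine ⟨i0, N - (n - 1), u', ⟨?_, ?_⟩, by omega, by omega, ?_⟩
  · rw [ug _ (by omega), ul 0 (by omega), ← hu.last]; congr 1; omega
  · intro j hj
    rcases lt_trichotomy j i0 with h | h | h
    · rw [ul _ h.le, ul _ h]; exact hu.lev j (by omega)
    · subst h
      rw [ul _ le_rfl, ug _ (by omega)]
      exact ⟨q, k', v0, by rw [← vn]; congr 1; omega⟩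
    · rw [ug _ h, ug _ (by omega), show j + 1 + (n - 1) = j + (n - 1) + 1 by omega]
      exact hu.lev _ (by omega)
  · funext j
    rcases le_or_gt j i0 with h | h
    · rw [ex_le h, ul _ h]
    rcases le_or_gt (i0 + n) j with h' | h'
    · rw [ex_ge hn h', ug _ (by omega)]; congr 1; omega
    · rw [ex_mid h.le h'.le, ul _ le_rfl, ug _ (by omega), show i0 + 1 + (n - 1) = i0 + n by omega,
        v0, vn]
      have := vals (j - i0) (by omega)
      rw [show i0 + (j - i0) = j by omega, hk', pow_succ] at this
      rw [this]; push_cast [Nat.cast_sub h.le]; field_simp; ring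

def LL {G : Type*} [Group G] (X : Set G) (k : ℕ) (g : G) : Prop :=
  ∃ w : List G, w.length ≤ k ∧ (∀ x ∈ w, x ∈ X ∨ x⁻¹ ∈ X) ∧ w.prod = g

section
variable {G : Type*} [Group G] {X : Set G}

lemma LL.mono {k l : ℕ} {g : G} (h : LL X k g) (hkl : k ≤ l) : LL X l g := by
  obtain ⟨w, h1, h2⟩ := h
  exact ⟨w, h1.trans hkl, h2⟩

lemma LL.one : LL X 0 (1 : G) := ⟨[], by simp, by simp, by simp⟩

lemma LL.of {g : G} (h : g ∈ X) : LL X 1 g := ⟨[g], by simp, by simp [h], by simp⟩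

lemma LL.mul {k l : ℕ} {g h : G} (hg : LL X k g) (hh : LL X l h) : LL X (k + l) (g * h) := by
  obtain ⟨w, h1, h2, rfl⟩ := hg
  obtain ⟨v, h3, h4, rfl⟩ := hh
  refine ⟨w ++ v, by rw [List.length_append]; omega, ?_, by simp⟩
  intro x hx
  rcases List.mem_append.1 hx with hx | hx
  · exact h2 x hx
  · exact h4 x hx

lemma LL.inv {k : ℕ} {g : G} (hg : LL X k g) : LL X k g⁻¹ := by
  obtain ⟨w, h1, h2, rfl⟩ := hg
  refine ⟨(w.map (·⁻¹)).reverse, by simpa, ?_, by rw [List.prod_inv_reverse]⟩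
  intro x hx
  simp only [List.mem_reverse, List.mem_map] at hx
  obtain ⟨y, hy, rfl⟩ := hx
  rw [inv_inv]
  exact (h2 y hy).symm

lemma LL.pow {k : ℕ} {g : G} (hg : LL X k g) (m : ℕ) : LL X (m * k) (g ^ m) := by
  induction m with
  | zero => simpa using LL.one
  | succ m ih => rw [pow_succ, Nat.succ_mul]; exact ih.mul hg
end

section FLs
variable {n : ℕ} (hn : 2 ≤ n) {x : ℕ → Circle ≃ₜ Circle}
    (hx : ∀ i m, i < (n - 1) * m → Maps (NN n (m + 1)) (x i) (ex n i (V n m)) (V n (m + 1)))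
    {X : Set (Circle ≃ₜ Circle)} (hX : ∀ i, i < n → x i ∈ X)

include hn hx in
lemma x_form (r : ℕ) (hr : 1 ≤ r) (b : ℕ) : x (r + (n - 1) * b) = (x 0) ^ b * x r * ((x 0) ^ b)⁻¹ := by
  induction b with
  | zero => simp
  | succ b ih =>
    rw [Nat.mul_succ, ← add_assoc, rel_x hn hx (by omega), ih, pow_succ']
    group

include hn hx in
lemma x_form' (i : ℕ) : ∃ r, r < n ∧ x i = (x 0) ^ ((i - 1) / (n - 1)) * x r *
    ((x 0) ^ ((i - 1) / (n - 1)))⁻¹ := by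
  rcases Nat.eq_zero_or_pos i with rfl | hi
  · exact ⟨0, by omega, by simp⟩
  · refine ⟨(i - 1) % (n - 1) + 1, ?_, ?_⟩
    · have := Nat.mod_lt (i - 1) (show 0 < n - 1 by omega)
      omega
    · rw [← x_form hn hx _ (by omega)]
      congr 1
      have := Nat.mod_add_div (i - 1) (n - 1)
      omega

include hn hx hX in
lemma FL (m : ℕ) : ∀ (a : ℕ) (u : ℕ → ℝ), Part n (NN n m) u → u 0 = 0 →
    (∀ i, Expo n (NN n m) u i → (i - 1) / (n - 1) ≤ a) →
    ∃ g, Maps (NN n m) g u (V n m) ∧ LL X (m + a) (((x 0) ^ a)⁻¹ * g) := by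
  have hx0 : LL X 1 (x 0) := LL.of (hX 0 (by omega))
  induction m with
  | zero =>
    intro a u hu hu0 _
    refine ⟨1, ?_, ?_⟩
    · intro i hi s h0 h1
      have : i = 0 := by simpa [NN] using hi
      subst this
      have hl := hu.last
      simp only [NN, mul_zero, add_zero] at hl
      simp [hl, hu0, V, homeo_one_apply]
    · simpa using ((hx0.pow a).inv)
  | succ m ih =>
    intro a u hu hu0 he
    classical
    obtain ⟨j0, hj0⟩ := exists_expo hn hu hu0 (by rw [NN_succ]; unfold NN; omega)
    have bound : ∀ j, Expo n (NN n (m + 1)) u j → j ≤ NN n (m + 1) := by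
      rintro j ⟨N', u', _, h1, h2, _⟩
      omega
    set i := Nat.findGreatest (Expo n (NN n (m + 1)) u) (NN n (m + 1)) with hidef
    have hi : Expo n (NN n (m + 1)) u i := Nat.findGreatest_spec (bound _ hj0) hj0
    have himax : ∀ j, Expo n (NN n (m + 1)) u j → j ≤ i := fun j hj =>
      Nat.le_findGreatest (bound _ hj) hj
    have hia := he i hi
    clear hidef
    clear_value i
    obtain ⟨N', u', hu', hiN, hNN, rfl⟩ := hi
    have hN' : N' = NN n m := by rw [NN_succ] at hNN; omega
    subst hN'
    have hu0' : u' 0 = 0 := by rw [← hu0, ex_le (by omega)]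
    have hj : ∀ j, Expo n (NN n m) u' j → j ≤ i := by
      rintro j ⟨N'', u'', hu'', hjN, hN'', rfl⟩
      by_contra hc
      have : Expo n (NN n (m + 1)) (ex n i (ex n j u'')) (j + (n - 1)) :=
        ⟨N'' + (n - 1), ex n i u'', hu''.ex hn (by omega), by omega, by omega,
          (ex_comm hn (by omega) _).symm⟩
      have := himax _ this
      omega
    have hj' : ∀ j, Expo n (NN n m) u' j → (j - 1) / (n - 1) ≤ (i - 1) / (n - 1) := fun j h =>
      Nat.div_le_div_right (by have := hj j h; omega)
    rcases (show i ≤ (n - 1) * m by unfold NN at hiN; omega).eq_or_lt with h | h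
    · obtain ⟨g, hg, hL⟩ := ih a u' hu' hu0' (fun j h => (hj' j h).trans hia)
      refine ⟨g, ?_, hL.mono (by omega)⟩
      have := hg.ex hn hiN
      rw [← NN_succ] at this
      nth_rewrite 2 [h] at this
      exact this
    · obtain ⟨g, hg, hL⟩ := ih _ u' hu' hu0' hj'
      refine ⟨x i * g, ?_, ?_⟩
      · have := hg.ex hn hiN
        rw [← NN_succ] at this
        exact this.comp (hx i m h)
      · obtain ⟨r, hr, hxr⟩ := x_form' hn hx i
        rw [hxr]
        obtain ⟨c, rfl⟩ := Nat.exists_eq_add_of_le hia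
        have := (((hx0.pow c).inv).mul (LL.of (hX r hr))).mul hL
        convert this.mono _ using 1
        · rw [pow_add]; group
        · omega

include hn hx hX in
lemma FL' (m : ℕ) (u : ℕ → ℝ) (hu : Part n (NN n m) u) (hu0 : u 0 = 0) :
    ∃ g, Maps (NN n m) g u (V n m) ∧ LL X (3 * m) g := by
  obtain ⟨g, hg, hL⟩ := FL hn hx hX m m u hu hu0 (by
    rintro i ⟨N', u', _, h1, h2, _⟩
    rw [Nat.div_le_iff_le_mul_add_pred (by omega)]
    unfold NN at h2
    omega)
  refine ⟨g, hg, ?_⟩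
  have := ((LL.of (hX 0 (by omega))).pow m).mul hL
  rw [mul_inv_cancel_left] at this
  exact this.mono (by omega)
end FLs

lemma exists_rho {n : ℕ} (hn : 2 ≤ n) : ∃ ρ ∈ Tn n, ∀ x : ℝ, ρ (x : Circle) = ((x + 1 / n : ℝ) : Circle) := by
  have hn0 : (0 : ℝ) < n := by positivity
  have hP : ∀ x, OrderIso.addRight (1 / (n : ℝ)) (x + 1) = OrderIso.addRight (1 / (n : ℝ)) x + 1 := by
    intro x; simp [OrderIso.addRight]; ring
  obtain ⟨f, hf⟩ := exists_homeo (OrderIso.addRight (1 / (n : ℝ))) hP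
  have hf' : ∀ x : ℝ, f (x : Circle) = ((x + 1 / n : ℝ) : Circle) := fun x => hf x
  refine ⟨f, Subgroup.subset_closure ?_, hf'⟩
  refine InT_of hn ⟨_, hP, hf⟩ n (fun i => i / n) (by omega) (by simp) (by field_simp) ?_ ?_
  · intro i _
    gcongr
    simp
  · intro i hi
    refine ⟨[⟨i, hi⟩], [⟨(i + 1) % n, Nat.mod_lt _ (by omega)⟩], by simp [bt], by simp [bt], ?_⟩
    intro s h0 h1
    rw [hf', coe_eq_iff]
    refine ⟨((i + 1) / n : ℕ), ?_⟩
    have := Nat.mod_add_div (i + 1) n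
    have e : (((i + 1) % n : ℕ) : ℝ) + n * ((i + 1) / n : ℕ) = i + 1 := by exact_mod_cast this
    simp only [bt]
    rw [Int.cast_natCast]
    field_simp
    linarith

lemma rho_pow {n : ℕ} {ρ : Circle ≃ₜ Circle}
    (h : ∀ x : ℝ, ρ (x : Circle) = ((x + 1 / n : ℝ) : Circle)) (r : ℕ) (x : ℝ) :
    (ρ ^ r) (x : Circle) = ((x + r / n : ℝ) : Circle) := by
  induction r generalizing x with
  | zero => rw [pow_zero, homeo_one_apply]; simp
  | succ r ih =>
    rw [pow_succ, homeo_mul_apply, h, ih]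
    congr 1
    push_cast; ring

lemma exists_partition {n : ℕ} (hn : 2 ≤ n) {f : Circle ≃ₜ Circle} (hf : EG n f) :
    ∃ m t, m ≤ cpx n f ∧ Part n (NN n m) t ∧ t 0 = 0 ∧
      ∀ i, i < NN n m → ∃ w w' : List (Fin n), t i = bt n w 0 ∧ t (i + 1) = bt n w 1 ∧
        (∀ s, bt n w s = t i + s * (t (i + 1) - t i)) ∧ MapsW n f w w' := by
  classical
  have hn0 : (0 : ℝ) < n := by positivity
  have hn1 : (1 : ℝ) < n := by exact_mod_cast hn
  have hfin := Bad_finite hf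
  let Q : ℕ → Prop := fun m => ∃ t, Part n (NN n m) t ∧ t 0 = 0 ∧ ∃ I : Finset (List (Fin n)),
    (∀ v ∈ I, v ∈ Bad n f) ∧ I.card = m ∧
      ∀ v ∈ I, ∃ j, j ≤ NN n m ∧ bt n v 0 < t j ∧ t j < bt n v 1
  have Qb : ∀ m, Q m → m ≤ cpx n f := by
    rintro m ⟨t, _, _, I, h1, h2, _⟩
    rw [← h2, ← Set.ncard_coe_finset]
    exact Set.ncard_le_ncard (fun v hv => h1 v hv) hfin
  have Q0 : Q 0 := ⟨V n 0, V_part hn 0, V_zero n 0, ∅, by simp, by simp, by simp⟩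
  have hs : Q (Nat.findGreatest Q (cpx n f)) := Nat.findGreatest_spec (Nat.zero_le _) Q0
  have hmax : ∀ m, Q m → m ≤ Nat.findGreatest Q (cpx n f) := fun m h =>
    Nat.le_findGreatest (Qb m h) h
  generalize Nat.findGreatest Q (cpx n f) = m at hs hmax
  refine ⟨m, ?_⟩
  have hmc := Qb m hs
  obtain ⟨t, ht, ht0, I, h1, h2, h3⟩ := hs
  refine ⟨t, hmc, ht, ht0, fun i hi => ?_⟩
  obtain ⟨w, hw0, hw1, hw⟩ := ht.word hn ht0 hi
  suffices hg : Good n f w by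
    obtain ⟨w', hw'⟩ := hg
    exact ⟨w, w', hw0, hw1, hw, hw'⟩
  by_contra hbad
  have hinc := ht.inc hn
  have hwI : w ∉ I := by
    intro hwI
    obtain ⟨j, hj, ha, hb⟩ := h3 w hwI
    rw [← hw0] at ha
    rw [← hw1] at hb
    rcases le_or_gt j i with h | h
    · have := mono_of_inc hinc h hi.le
      linarith
    · have := mono_of_inc hinc (show i + 1 ≤ j from h) hj
      linarith
  have : Q (m + 1) := by
    refine ⟨ex n i t, by rw [NN_succ]; exact ht.ex hn hi, by rw [ex_le (by omega), ht0],
      insert w I, ?_, by rw [Finset.card_insert_of_notMem hwI, h2], ?_⟩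
    · intro v hv
      rcases Finset.mem_insert.1 hv with rfl | hv
      · exact hbad
      · exact h1 v hv
    · intro v hv
      rw [NN_succ]
      rcases Finset.mem_insert.1 hv with rfl | hv
      · refine ⟨i + 1, by omega, ?_⟩
        rw [← hw0, ← hw1, ex_mid (by omega) (by omega)]
        have := hinc i hi
        have e : (((i + 1 : ℕ) : ℝ) - i) / n = 1 / n := by push_cast; ring
        rw [e]
        have l : 1 / (n : ℝ) < 1 := by rw [div_lt_one hn0]; exact hn1
        have p : 0 < 1 / (n : ℝ) := by positivity
        constructor <;> nlinarith
      · obtain ⟨j, hj, hab⟩ := h3 v hv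
        rcases le_or_gt j i with h | h
        · exact ⟨j, by omega, by rwa [ex_le h]⟩
        · exact ⟨j + (n - 1), by omega, by rwa [ex_ge' hn h]⟩
  have := hmax _ this
  omega

lemma exists_image {n : ℕ} (hn : 2 ≤ n) {f : Circle ≃ₜ Circle} (hf : EG n f) (hQ : QL f) :
    ∃ m t u, m ≤ cpx n f ∧ Part n (NN n m) t ∧ t 0 = 0 ∧ Part n (NN n m) u ∧
      Maps (NN n m) f t u := by
  obtain ⟨m, t, hm, ht, ht0, hp⟩ := exists_partition hn hf
  obtain ⟨P, hP, hl⟩ := hQ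
  have hn0 : (0 : ℝ) < n := by positivity
  refine ⟨m, t, fun i => P (t i), hm, ht, ht0, ⟨?_, ?_⟩, ?_⟩
  · rw [ht.last, hP]
  · intro i hi
    obtain ⟨w, w', h0, h1, h2, h3⟩ := hp i hi
    have a0 := h3 0 le_rfl zero_le_one
    rw [hl, coe_eq_iff] at a0
    obtain ⟨z, hz⟩ := a0
    have a1 := lift_good hn hP hl h3 zero_le_one le_rfl
    obtain ⟨b, -, hb⟩ := bt_int n w'
    rw [hb] at hz
    refine ⟨b + z * n ^ w'.length, w'.length, ?_, ?_⟩
    · rw [h0, hz]; push_cast; field_simp; ring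
    · rw [h1, a1, hz]; push_cast; field_simp; ring
  · intro i hi s s0 s1
    obtain ⟨w, w', h0, h1, h2, h3⟩ := hp i hi
    dsimp only
    rw [← h2, hl, h0, h1, lift_good hn hP hl h3 s0 s1, lift_good hn hP hl h3 zero_le_one le_rfl]
    congr 1
    ring

def sh (N s : ℕ) (t : ℕ → ℝ) (i : ℕ) : ℝ := if i + s ≤ N then t (i + s) else t (i + s - N) + 1

lemma sh_le {N s i : ℕ} {t : ℕ → ℝ} (h : i + s ≤ N) : sh N s t i = t (i + s) := if_pos h

lemma sh_ge {N s i : ℕ} {t : ℕ → ℝ} (hN : t N = t 0 + 1) (h : N ≤ i + s) :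
    sh N s t i = t (i + s - N) + 1 := by
  rcases h.eq_or_lt with h | h
  · rw [sh_le h.ge, ← h, hN, Nat.sub_self]
  · exact if_neg (by omega)

lemma Part.sh {n N s : ℕ} (hn : 2 ≤ n) {t : ℕ → ℝ} (h : Part n N t) (hs : s ≤ N) :
    Part n N (sh N s t) := by
  have hn0 : (0 : ℝ) < n := by positivity
  refine ⟨?_, ?_⟩
  · rw [sh_ge h.last (by omega), sh_le (by omega)]
    simp
  · intro i hi
    rcases lt_or_ge (i + s) N with h1 | h1
    · rw [sh_le h1.le, sh_le (by omega), show i + 1 + s = i + s + 1 by omega]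
      exact h.lev _ h1
    · rw [sh_ge h.last h1, sh_ge h.last (by omega), show i + 1 + s - N = i + s - N + 1 by omega]
      obtain ⟨a, k, ha, hb⟩ := h.lev (i + s - N) (by omega)
      refine ⟨a + n ^ k, k, ?_, ?_⟩
      · rw [ha]; push_cast; field_simp
      · rw [hb]; push_cast; field_simp; ring

lemma Maps.sh {N s : ℕ} {f : Circle ≃ₜ Circle} {t u : ℕ → ℝ} (h : Maps N f t u)
    (ht : t N = t 0 + 1) (hu : u N = u 0 + 1) (hs : s ≤ N) : Maps N f (sh N s t) (sh N s u) := by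
  intro i hi r h0 h1
  rcases lt_or_ge (i + s) N with h2 | h2
  · rw [sh_le h2.le, sh_le h2.le, sh_le (by omega), sh_le (by omega),
      show i + 1 + s = i + s + 1 by omega]
    exact h _ h2 r h0 h1
  · rw [sh_ge ht h2, sh_ge ht (by omega), sh_ge hu h2, sh_ge hu (by omega),
      show i + 1 + s - N = i + s - N + 1 by omega]
    have := h (i + s - N) (by omega) r h0 h1
    have e : ∀ A B : ℝ, ((A + 1 + r * (B + 1 - (A + 1)) : ℝ) : Circle)
        = ((A + r * (B - A) : ℝ) : Circle) := by
      intro A B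
      rw [coe_eq_iff]
      exact ⟨1, by push_cast; ring⟩
    rw [e, e, this]

lemma Part.sub_int {n N : ℕ} (hn : 2 ≤ n) {t : ℕ → ℝ} (h : Part n N t) (z : ℤ) :
    Part n N (fun i => t i - z) := by
  have hn0 : (0 : ℝ) < n := by positivity
  refine ⟨by rw [h.last]; ring, fun i hi => ?_⟩
  obtain ⟨a, k, ha, hb⟩ := h.lev i hi
  refine ⟨a - z * n ^ k, k, ?_, ?_⟩
  · rw [ha]; push_cast; field_simp
  · rw [hb]; push_cast; field_simp; ring

lemma Maps.sub_int {N : ℕ} {f : Circle ≃ₜ Circle} {t u : ℕ → ℝ} (h : Maps N f t u) (z : ℤ) :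
    Maps N f t (fun i => u i - z) := by
  intro i hi s h0 h1
  rw [h i hi s h0 h1, coe_eq_iff]
  exact ⟨z, by ring⟩

lemma Part.sub_r {n N r : ℕ} (hn : 2 ≤ n) {t : ℕ → ℝ} (h : Part n N t) (hr : r = 0 ∨ 1 < N) :
    Part n N (fun i => t i - r / n) := by
  have hn0 : (0 : ℝ) < n := by positivity
  rcases hr with rfl | hN
  · simpa using h
  refine ⟨by rw [h.last]; ring, fun i hi => ?_⟩
  obtain ⟨a, k, ha, hb⟩ := h.lev i hi
  have hl := h.level_pos hn hN hi
  obtain ⟨k, rfl⟩ : ∃ k', k = k' + 1 := by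
    rcases k with _ | k
    · rw [ha, hb] at hl; simp at hl
    · exact ⟨k, rfl⟩
  refine ⟨a - r * n ^ k, k + 1, ?_, ?_⟩
  · rw [ha]; push_cast; rw [pow_succ]; field_simp
  · rw [hb]; push_cast; rw [pow_succ]; field_simp; ring

lemma Part.exists_int {n N : ℕ} (hn : 2 ≤ n) {u : ℕ → ℝ} (h : Part n N u) :
    ∃ s, s < N ∧ ∃ z : ℤ, u s = z := by
  have hn0 : (0 : ℝ) < n := by positivity
  obtain ⟨s, hs, h1, h2⟩ := h.find hn (x := ⌈u 0⌉) (Int.le_ceil _) (Int.ceil_lt_add_one _)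
  refine ⟨s, hs, ⌈u 0⌉, ?_⟩
  obtain ⟨a, k, ha, hb⟩ := h.lev s hs
  have hp : (0 : ℝ) < (n : ℝ) ^ k := by positivity
  rw [ha, div_le_iff₀ hp] at h1
  rw [hb, lt_div_iff₀ hp] at h2
  have h1' : a ≤ ⌈u 0⌉ * (n : ℤ) ^ k := by exact_mod_cast h1
  have h2' : ⌈u 0⌉ * (n : ℤ) ^ k < a + 1 := by exact_mod_cast h2
  have e : a = ⌈u 0⌉ * (n : ℤ) ^ k := by omega
  have e' : (a : ℝ) = ⌈u 0⌉ * (n : ℝ) ^ k := by exact_mod_cast e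
  rw [ha, e']
  field_simp

lemma x0_pow {n : ℕ} (hn : 2 ≤ n) {x : ℕ → Circle ≃ₜ Circle}
    (hx : ∀ i m, i < (n - 1) * m → Maps (NN n (m + 1)) (x i) (ex n i (V n m)) (V n (m + 1)))
    (k : ℕ) (hk : 1 ≤ k) (a : ℕ) :
    ∃ v, Part n (NN n (k + a)) v ∧ v 0 = 0 ∧ (∀ j, 1 ≤ j → v (j + (n - 1) * a) = V n k j) ∧
      Maps (NN n (k + a)) ((x 0) ^ a) v (V n (k + a)) := by
  induction a with
  | zero => exact ⟨V n k, V_part hn k, V_zero n k, by simp, Maps.one _ _⟩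
  | succ a ih =>
    obtain ⟨v, h1, h2, h3, h4⟩ := ih
    have hN : 0 < NN n (k + a) := by unfold NN; omega
    refine ⟨ex n 0 v, ?_, ?_, ?_, ?_⟩
    · rw [← add_assoc, NN_succ]; exact h1.ex hn hN
    · rw [ex_le le_rfl, h2]
    · intro j hj
      rw [Nat.mul_succ, ← add_assoc, ex_ge' hn (by omega), h3 j hj]
    · have := h4.ex hn hN
      rw [← NN_succ] at this
      rw [pow_succ', ← add_assoc]
      exact this.comp (hx 0 (k + a) (Nat.mul_pos (by omega) (by omega)))

theorem length_le {n : ℕ} (hn : 2 ≤ n) : ∃ X : Set (Circle ≃ₜ Circle), X.Finite ∧ X ⊆ Tn n ∧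
    ∀ f ∈ Tn n, LL X (10 * cpx n f + n) f := by
  choose x hxT hx using exists_x hn
  obtain ⟨ρ, hρT, hρ⟩ := exists_rho hn
  let X : Set (Circle ≃ₜ Circle) := insert ρ (x '' Set.Iio n)
  have hX : ∀ i, i < n → x i ∈ X := fun i hi => Set.mem_insert_of_mem _ ⟨i, hi, rfl⟩
  have hρX : LL X 1 ρ := LL.of (Set.mem_insert _ _)
  have hx0 : LL X 1 (x 0) := LL.of (hX 0 (by omega))
  refine ⟨X, ((Set.finite_Iio n).image x).insert ρ, ?_, ?_⟩
  · rintro g (rfl | ⟨i, _, rfl⟩)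
    · exact hρT
    · exact hxT i
  intro f hf
  obtain ⟨hE, hQ⟩ := Tn_props hn hf
  obtain ⟨m, t, u, hm, ht, ht0, hu, hM⟩ := exists_image hn hE hQ
  obtain ⟨gt, hgt, hLt⟩ := FL' hn hx hX m t ht ht0
  obtain ⟨s, hs, z, hz⟩ := hu.exists_int hn
  -- the map straightening the position of the integer point
  obtain ⟨a, r, v, ham, hrn, hrN, hv, hvs, hvm⟩ : ∃ a r v, a ≤ m ∧ r ≤ n ∧ (r = 0 ∨ 1 < NN n m) ∧
      Part n (NN n m) v ∧ v s = r / n ∧ Maps (NN n m) ((x 0) ^ a) v (V n m) := by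
    rcases Nat.eq_zero_or_pos s with rfl | hs0
    · exact ⟨0, 0, V n m, by omega, by omega, Or.inl rfl, V_part hn m, by simp [V_zero],
        Maps.one _ _⟩
    · have h1 : (s - 1) / (n - 1) < m := by
        rw [Nat.div_lt_iff_lt_mul (by omega), mul_comm]
        unfold NN at hs
        omega
      have h2 := Nat.mod_add_div (s - 1) (n - 1)
      have h3 := Nat.mod_lt (s - 1) (show 0 < n - 1 by omega)
      generalize (s - 1) / (n - 1) = a at *
      generalize (s - 1) % (n - 1) = r at *
      obtain ⟨v, k1, k2, k3, k4⟩ := x0_pow hn hx (m - a) (by omega) a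
      rw [show m - a + a = m by omega] at k1 k4
      refine ⟨a, r + 1, v, h1.le, by omega, Or.inr (by omega), k1, ?_, k4⟩
      rw [← V_r hn (show 1 ≤ m - a by omega) (show r + 1 ≤ n - 1 by omega), ← k3 _ (by omega)]
      congr 1
      omega
  have hv' := hv.sub_r hn hrN
  have hρm : Maps (NN n m) (ρ ^ r) (fun i => v i - r / n) v := by
    intro i hi q h0 h1
    rw [rho_pow hρ]
    congr 1
    ring
  have hf2 := ((hρm.comp hvm).comp hgt.inv).comp hM
  have hf3 := (hf2.sh hv'.last hu.last hs.le).sub_int z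
  obtain ⟨g1, hg1, hL1⟩ := FL' hn hx hX m _ (hv'.sh hn hs.le) (by
    rw [sh_le (by omega), zero_add, hvs, sub_self])
  obtain ⟨g2, hg2, hL2⟩ := FL' hn hx hX m _ ((hu.sh hn hs.le).sub_int hn z) (by
    rw [sh_le (by omega), zero_add, hz, sub_self])
  have key := Maps.unique hn (hv'.sh hn hs.le) (hf3.comp hg2) hg1
  have hfe : f = g2⁻¹ * g1 * (ρ ^ r)⁻¹ * ((x 0) ^ a)⁻¹ * gt := by
    rw [← key]; group
  have := (((hL2.inv.mul hL1).mul (hρX.pow r).inv).mul (hx0.pow a).inv).mul hLt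
  rw [← hfe] at this
  exact this.mono (by omega)

lemma wl_le {G : Type*} [Group G] {S : Set G} {k : ℕ} {g : G} (h : LL S k g) :
    wordLength S g ≤ k := by
  obtain ⟨w, h1, h2⟩ := h
  have : wordLength S g ≤ w.length := Nat.sInf_le ⟨w, rfl, h2⟩
  exact this.trans h1

lemma LL_wl {G : Type*} [Group G] {S : Set G} (hS : Subgroup.closure S = ⊤) (g : G) :
    LL S (wordLength S g) g := by
  have hex : ∃ k, LL S k g := by
    have hg : g ∈ Subgroup.closure S := by rw [hS]; trivial
    induction hg using Subgroup.closure_induction with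
    | mem x hx => exact ⟨1, LL.of hx⟩
    | one => exact ⟨0, LL.one⟩
    | mul x y _ _ hx hy => exact ⟨_, hx.choose_spec.mul hy.choose_spec⟩
    | inv x _ hx => exact ⟨_, hx.choose_spec.inv⟩
  obtain ⟨_, w, -, h2, h3⟩ := hex
  have hne : { k : ℕ | ∃ w : List G, w.length = k ∧ (∀ x ∈ w, x ∈ S ∨ x⁻¹ ∈ S) ∧ w.prod = g }.Nonempty :=
    ⟨w.length, w, rfl, h2, h3⟩
  obtain ⟨v, e, hv⟩ := Nat.sInf_mem hne
  exact ⟨v, e.le, hv⟩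

lemma subadd {G : Type*} [Group G] {S : Set G} (hS : S.Finite) (F : G → ℕ) (h1 : F 1 = 0)
    (hm : ∀ g h, F (g * h) ≤ F g + F h) : ∃ M, ∀ k g, LL S k g → F g ≤ M * k := by
  have hfin : (S ∪ S⁻¹).Finite := hS.union hS.inv
  obtain ⟨M, hM⟩ := (hfin.image F).bddAbove
  refine ⟨M, ?_⟩
  rintro k g ⟨w, hk, hw, rfl⟩
  have : F w.prod ≤ M * w.length := by
    clear hk
    induction w with
    | nil => simp [h1]
    | cons a w ih =>
      rw [List.prod_cons, List.length_cons, Nat.mul_succ]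
      have e1 := hm a w.prod
      have e2 := ih fun x hx => hw x (List.mem_cons_of_mem _ hx)
      have e3 : F a ≤ M := hM ⟨a, by
        rcases hw a List.mem_cons_self with h | h
        · exact Or.inl h
        · exact Or.inr h, rfl⟩
      omega
  exact this.trans (Nat.mul_le_mul_left _ hk)

lemma wl_one {G : Type*} [Group G] (S : Set G) : wordLength S (1 : G) = 0 :=
  Nat.le_zero.1 (wl_le LL.one)

lemma wl_mul {G : Type*} [Group G] {S : Set G} (hS : Subgroup.closure S = ⊤) (g h : G) :
    wordLength S (g * h) ≤ wordLength S g + wordLength S h :=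
  wl_le ((LL_wl hS g).mul (LL_wl hS h))

lemma LL_lift {G : Type*} [Group G] {K : Subgroup G} {X : Set G} (hX : X ⊆ K) {k : ℕ} {g : K}
    (h : LL X k (g : G)) : LL ((↑) ⁻¹' X : Set K) k g := by
  obtain ⟨w, h1, h2, h3⟩ := h
  have hK : ∀ x ∈ w, x ∈ K := by
    intro x hx
    rcases h2 x hx with h | h
    · exact hX h
    · exact K.inv_mem_iff.1 (hX h)
  lift w to List K using hK
  refine ⟨w, by simpa using h1, fun x hx => ?_, ?_⟩
  · exact h2 x (List.mem_map_of_mem hx)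
  · apply Subtype.ext
    rw [← h3]
    simp

/-- Let `n ≥ 2`.  There exists an injective group homomorphism `φ`
from `T_n` into `T_2 = T` which is a quasi-isometric embedding: for any finite generating
set `Σ` of `T_n` and any finite generating set `S` of `T_2`, there exist constants
`A ≥ 1` and `B ≥ 0` such that for all `ω ∈ T_n`,
`(1/A)·|ω|_Σ - B ≤ |φ(ω)|_S ≤ A·|ω|_Σ + B`. -/
theorem qi_embedding_Tn_to_T2 (n : ℕ) (hn : 2 ≤ n) :
    ∃ φ : Tn n →* Tn 2, Function.Injective φ ∧
      ∀ T : Finset (Tn n), Subgroup.closure (T : Set (Tn n)) = ⊤ →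
      ∀ S : Finset (Tn 2), Subgroup.closure (S : Set (Tn 2)) = ⊤ →
      ∃ A B : ℝ, 1 ≤ A ∧ 0 ≤ B ∧ ∀ ω : Tn n,
        (1 / A) * (wordLength (T : Set (Tn n)) ω : ℝ) - B ≤
            (wordLength (S : Set (Tn 2)) (φ ω) : ℝ) ∧
        (wordLength (S : Set (Tn 2)) (φ ω) : ℝ) ≤
            A * (wordLength (T : Set (Tn n)) ω : ℝ) + B := by
  obtain ⟨H, hH1, hH0, hHd⟩ := exists_H hn
  obtain ⟨h, hh⟩ := exists_homeo H hH1
  have hle : Tn n ≤ (Tn 2).comap (MulAut.conj h).toMonoidHom := by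
    rw [Tn, Subgroup.closure_le]
    intro f hf
    exact Subgroup.subset_closure (conj_InT hn H hH1 hH0 hHd h hh hf)
  let φ : Tn n →* Tn 2 :=
    ((MulAut.conj h).toMonoidHom.comp (Tn n).subtype).codRestrict (Tn 2) fun ω => hle ω.2
  have hφ : ∀ ω, ((φ ω : Tn 2) : Circle ≃ₜ Circle) = h * ω * h⁻¹ := fun ω => rfl
  refine ⟨φ, ?_, ?_⟩
  · intro a b hab
    have := congrArg (Subtype.val) hab
    rw [hφ, hφ] at this
    exact Subtype.ext (mul_left_cancel (mul_right_cancel this))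
  intro T hT S hS
  obtain ⟨X, hXf, hXT, hX⟩ := length_le hn
  obtain ⟨M1, hM1⟩ := subadd T.finite_toSet (fun ω => wordLength (S : Set (Tn 2)) (φ ω))
    (by simp only [map_one]; exact wl_one _)
    (fun g k => by simp only [map_mul]; exact wl_mul hS _ _)
  obtain ⟨M2, hM2⟩ := subadd S.finite_toSet (fun ω : Tn 2 => cpx 2 (ω : Circle ≃ₜ Circle))
    (cpx_one 2) (fun g k => cpx_mul le_rfl (Tn_props le_rfl k.2).1 (Tn_props le_rfl g.2).1)
  obtain ⟨M3, hM3⟩ := subadd (hXf.preimage (Subtype.val_injective.injOn))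
    (fun ω : Tn n => wordLength (T : Set (Tn n)) ω) (wl_one _) (fun g k => wl_mul hT _ _)
  refine ⟨M3 * (10 * M2) + M1 + 1, M3 * n, ?_, by positivity, fun ω => ?_⟩
  · have : (0 : ℝ) ≤ M3 * (10 * M2) + M1 := by positivity
    linarith
  have u1 := hM1 _ _ (LL_wl hT ω)
  have l1 := hM3 _ _ (LL_lift hXT (hX ω ω.2))
  have l2 := hM2 _ _ (LL_wl hS (φ ω))
  have l3 := cpx_conj hn H hH1 hH0 hHd h hh (Tn_props hn ω.2).1 (Tn_props le_rfl (φ ω).2).1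
  rw [← hφ] at l3
  have l4 : wordLength (T : Set (Tn n)) ω ≤
      M3 * (10 * (M2 * wordLength (S : Set (Tn 2)) (φ ω)) + n) :=
    l1.trans (Nat.mul_le_mul_left _ (by omega))
  generalize wordLength (S : Set (Tn 2)) (φ ω) = a at *
  generalize wordLength (T : Set (Tn n)) ω = b at *
  have l4' : (b : ℝ) ≤ M3 * (10 * (M2 * a) + n) := by exact_mod_cast l4
  have u1' : (a : ℝ) ≤ M1 * b := by exact_mod_cast u1
  have p1 : (0 : ℝ) ≤ M3 * (10 * M2) := by positivity
  have p2 : (0 : ℝ) ≤ M1 := by positivity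
  have p3 : (0 : ℝ) ≤ M3 * n := by positivity
  have pa : (0 : ℝ) ≤ a := by positivity
  have pb : (0 : ℝ) ≤ b := by positivity
  have pA : (0 : ℝ) < M3 * (10 * M2) + M1 + 1 := by positivity
  constructor
  · rw [sub_le_iff_le_add, one_div, inv_mul_le_iff₀ pA]
    have q1 := mul_nonneg p1 p3
    have q2 := mul_nonneg p2 p3
    have q3 := mul_nonneg p2 pa
    nlinarith
  · have q1 := mul_nonneg p1 pb
    nlinarith

end ThompsonPaper
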